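/- arXiv:2207.03423 — 3 statements merged into one kernel-verified Lean document; each statement's English description precedes it below -/
import Mathlib

section
/- Fix a real number N > 1. There exist constants C > 0 and w̄ > 0, depending only on N, such that for all D ≥ D' > 0, every probability CD(0,N) density h on [0,D'], and every interval set E ⊆ [0,D'] with 0 < m_h(E) ≤ w̄, one has P_h(E) ≥ (N/D) · m_h(E)^{1−1/N} · (1 − C·m_h(E)^{1/N}). -/
open MeasureTheory
open scoped Classical

noncomputable section

/-- A `CD(0,N)` density on `[0, D']`: nonnegative on `[0, D']`, positive on `(0, D')`,
and `h^{1/(N-1)}` is concave on `[0, D']`. -/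
def IsCDDensity (N D' : ℝ) (h : ℝ → ℝ) : Prop :=
  (∀ x ∈ Set.Icc (0:ℝ) D', 0 ≤ h x) ∧
  (∀ x ∈ Set.Ioo (0:ℝ) D', 0 < h x) ∧
  ConcaveOn ℝ (Set.Icc (0:ℝ) D') (fun x => h x ^ (1 / (N - 1)))

/-- A probability `CD(0,N)` density on `[0, D']`. -/
def IsProbCDDensity (N D' : ℝ) (h : ℝ → ℝ) : Prop :=
  IsCDDensity N D' h ∧ (∫ x in Set.Icc (0:ℝ) D', h x) = 1

/-- A decomposition of an "interval set" `E ⊆ [0, D']`: up to a Lebesgue-null set, `E` is an at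
most countable union of pairwise separated open intervals (degenerate intervals `a i = b i`
are allowed, so that finite families are covered); the summability field expresses that the
perimeter of `E` with respect to the density `h` is a (finite) real number. -/
structure IntervalDecomp (D' : ℝ) (h : ℝ → ℝ) (E : Set ℝ) where
  a : ℕ → ℝ
  b : ℕ → ℝ
  nonneg : ∀ i, 0 ≤ a i
  le : ∀ i, a i ≤ b i
  le_top : ∀ i, b i ≤ D'
  sep : ∀ i j, i ≠ j → b i ≤ a j ∨ b j ≤ a i
  aeEq : E =ᵐ[volume] ⋃ i, Set.Ioo (a i) (b i)
  summablePerim : Summable fun i =>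
    (if a i < b i ∧ a i ≠ 0 then h (a i) else 0) +
    (if a i < b i ∧ b i ≠ D' then h (b i) else 0)

/-- The weighted perimeter `P_h(E) = Σ_{i : a_i ≠ 0} h(a_i) + Σ_{i : b_i ≠ D'} h(b_i)`
of an interval set, computed from a decomposition. -/
def IntervalDecomp.perim {D' : ℝ} {h : ℝ → ℝ} {E : Set ℝ}
    (d : IntervalDecomp D' h E) : ℝ :=
  ∑' i, ((if d.a i < d.b i ∧ d.a i ≠ 0 then h (d.a i) else 0) +
         (if d.a i < d.b i ∧ d.b i ≠ D' then h (d.b i) else 0))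


/-- Basic facts: integrability, continuity in the interior. -/
lemma milman_intble {N D' : ℝ} {h : ℝ → ℝ} (H : IsProbCDDensity N D' h) :
    IntegrableOn h (Set.Icc 0 D') := by
  by_contra hc
  have := H.2
  rw [integral_undef hc] at this
  exact zero_ne_one this

lemma milman_cont {N D' : ℝ} (hN : 1 < N) {h : ℝ → ℝ} (H : IsProbCDDensity N D' h) :
    ContinuousOn h (Set.Ioo 0 D') := by
  have h1 := H.1.2.2.continuousOn_interior
  rw [interior_Icc] at h1
  have h2 : ContinuousOn (fun x => (h x ^ (1 / (N - 1))) ^ (N - 1)) (Set.Ioo 0 D') :=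
    h1.rpow_const (fun x _ => Or.inr (by linarith))
  refine h2.congr ?_
  intro x hx
  have hpos := H.1.2.1 x hx
  have hN' : N - 1 ≠ 0 := by linarith
  simp only
  rw [← Real.rpow_mul hpos.le, one_div_mul_cancel hN', Real.rpow_one]

lemma milman_ii {N D' : ℝ} {h : ℝ → ℝ} (H : IsProbCDDensity N D' h) {x y : ℝ}
    (hx : x ∈ Set.Icc 0 D') (hy : y ∈ Set.Icc 0 D') : IntervalIntegrable h volume x y := by
  have h1 : IntegrableOn h (Set.uIcc x y) :=
    (milman_intble H).mono_set (Set.uIcc_subset_Icc hx hy)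
  exact h1.intervalIntegrable

lemma milman_deriv {N D' : ℝ} (hN : 1 < N) {h : ℝ → ℝ} (H : IsProbCDDensity N D' h) {x : ℝ}
    (hx : x ∈ Set.Ioo 0 D') : HasDerivAt (fun y => ∫ t in (0:ℝ)..y, h t) (h x) x := by
  have hc := milman_cont hN H
  refine intervalIntegral.integral_hasDerivAt_right
    (milman_ii H ⟨le_rfl, (hx.1.trans hx.2).le⟩ ⟨hx.1.le, hx.2.le⟩) ?_ ?_
  · exact hc.stronglyMeasurableAtFilter isOpen_Ioo x hx
  · exact hc.continuousAt (isOpen_Ioo.mem_nhds hx)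

lemma milman_Fcont {N D' : ℝ} {h : ℝ → ℝ} (hD : 0 < D') (H : IsProbCDDensity N D' h) :
    ContinuousOn (fun y => ∫ t in (0:ℝ)..y, h t) (Set.Icc 0 D') := by
  have := intervalIntegral.continuousOn_primitive_interval
    (f := h) (μ := volume) (a := 0) (b := D') (by rw [Set.uIcc_of_le hD.le]; exact milman_intble H)
  rwa [Set.uIcc_of_le hD.le] at this

lemma milman_Fpos {N D' : ℝ} {h : ℝ → ℝ} (H : IsProbCDDensity N D' h) {x y : ℝ}
    (hx : 0 ≤ x) (hxy : x < y) (hy : y ≤ D') : 0 < ∫ t in x..y, h t := by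
  refine intervalIntegral.intervalIntegral_pos_of_pos_on
    (milman_ii H ⟨hx, by linarith⟩ ⟨by linarith, hy⟩) ?_ hxy
  intro t ht
  exact H.1.2.1 t ⟨by linarith [ht.1], by linarith [ht.2]⟩

lemma milman_Fone {N D' : ℝ} {h : ℝ → ℝ} (hD : 0 < D') (H : IsProbCDDensity N D' h) :
    ∫ t in (0:ℝ)..D', h t = 1 := by
  rw [intervalIntegral.integral_of_le hD.le, ← integral_Icc_eq_integral_Ioc, H.2]

lemma milman_Fsub {N D' : ℝ} {h : ℝ → ℝ} (H : IsProbCDDensity N D' h) {x y : ℝ}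
    (hx : x ∈ Set.Icc 0 D') (hy : y ∈ Set.Icc 0 D') :
    (∫ t in (0:ℝ)..y, h t) - ∫ t in (0:ℝ)..x, h t = ∫ t in x..y, h t := by
  have h0 : (0:ℝ) ∈ Set.Icc 0 D' := ⟨le_rfl, hx.1.trans hx.2⟩
  exact intervalIntegral.integral_interval_sub_left (milman_ii H h0 hy) (milman_ii H h0 hx)

/-- `g^N / F` is nonincreasing. -/
lemma milman_ratio {N D' : ℝ} (hN : 1 < N) {h : ℝ → ℝ} (hD : 0 < D')
    (H : IsProbCDDensity N D' h) {b x : ℝ} (hb : 0 < b) (hbx : b < x) (hx : x < D') :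
    (h x ^ (1 / (N - 1))) ^ N * (∫ t in (0:ℝ)..b, h t) ≤
      (h b ^ (1 / (N - 1))) ^ N * (∫ t in (0:ℝ)..x, h t) := by
  set F : ℝ → ℝ := fun y => ∫ t in (0:ℝ)..y, h t with hF
  set g : ℝ → ℝ := fun y => h y ^ (1 / (N - 1)) with hg
  change g x ^ N * F b ≤ g b ^ N * F x
  have hconc : ConcaveOn ℝ (Set.Icc 0 D') g := H.1.2.2
  have hgpos : ∀ y ∈ Set.Ioo 0 D', 0 < g y := fun y hy => Real.rpow_pos_of_pos (H.1.2.1 y hy) _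
  have hgnn : ∀ y ∈ Set.Icc 0 D', 0 ≤ g y := fun y hy => Real.rpow_nonneg (H.1.1 y hy) _
  have hgh : ∀ y ∈ Set.Ioo 0 D', h y = g y ^ (N - 1) := by
    intro y hy
    have hN' : N - 1 ≠ 0 := by linarith
    simp only [hg]
    rw [← Real.rpow_mul (H.1.2.1 y hy).le, one_div_mul_cancel hN', Real.rpow_one]
  have hFb : 0 < F b := milman_Fpos H le_rfl hb (by linarith)
  have hFx : F b < F x := by
    have h1 := milman_Fpos H hb.le hbx hx.le
    have h2 := milman_Fsub H (x := b) (y := x) ⟨hb.le, by linarith⟩ ⟨by linarith, hx.le⟩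
    simp only [hF]; linarith
  have hgb := hgpos b ⟨hb, by linarith⟩
  have hgx := hgpos x ⟨by linarith, hx⟩
  by_cases hs : g x ≤ g b
  · have : g x ^ N ≤ g b ^ N := Real.rpow_le_rpow hgx.le hs (by linarith)
    have h3 : 0 ≤ g b ^ N := Real.rpow_nonneg hgb.le _
    nlinarith
  push Not at hs
  set s := (g x - g b) / (x - b) with hsdef
  have hspos : 0 < s := div_pos (by linarith) (by linarith)
  set l : ℝ → ℝ := fun y => g b + s * (y - b) with hl
  have hlb : l b = g b := by simp [hl]
  have hlx : l x = g x := by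
    have : x - b ≠ 0 := by linarith
    simp only [hl, hsdef]; field_simp; ring
  have hleft : ∀ y, 0 ≤ y → y < b → g y ≤ l y := by
    intro y hy0 hyb
    have h1 := hconc.slope_anti_adjacent (x := y) (y := b) (z := x) ⟨hy0, by linarith⟩
      ⟨by linarith, hx.le⟩ hyb hbx
    rw [← hsdef, le_div_iff₀ (by linarith)] at h1
    simp only [hl]; linarith
  have hright : ∀ y, b < y → y < x → l y ≤ g y := by
    intro y hy0 hyb
    have h1 := hconc.slope_anti_adjacent (x := b) (y := y) (z := x) ⟨hb.le, by linarith⟩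
      ⟨by linarith, hx.le⟩ hy0 hyb
    have h2 : g x = g b + s * (x - b) := by rw [← hlx]
    rw [h2, div_le_div_iff₀ (by linarith) (by linarith)] at h1
    simp only [hl]
    have hxb : 0 < x - b := by linarith
    have : 0 ≤ (x - b) * (g y - (g b + s * (y - b))) := by nlinarith
    have := nonneg_of_mul_nonneg_right this hxb
    linarith
  have hlder : ∀ y, 0 < l y → HasDerivAt (fun y => l y ^ N / (s * N)) (l y ^ (N - 1)) y := by
    intro y hy
    have h1 : HasDerivAt l s y := by
      have := (((hasDerivAt_id y).sub_const b).const_mul s).const_add (g b)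
      simpa [hl] using this
    have h2 := (h1.rpow_const (p := N) (Or.inl hy.ne')).div_const (s * N)
    have hsN : s * N ≠ 0 := mul_ne_zero hspos.ne' (by linarith)
    rwa [mul_div_cancel_left₀ _ hsN] at h2
  have hlcont : Continuous (fun y => l y ^ N / (s * N)) := by
    have : Continuous l := by simp only [hl]; fun_prop
    exact (this.rpow_const (fun _ => Or.inr (by linarith))).div_const _
  have hFc : ContinuousOn F (Set.Icc 0 D') := milman_Fcont hD H
  have k1 : F b ≤ g b ^ N / (s * N) := by
    have hm : MonotoneOn (fun y => l y ^ N / (s * N) - F y) (Set.Icc 0 b) := by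
      have hd : ∀ y ∈ interior (Set.Icc 0 b),
          HasDerivAt (fun y => l y ^ N / (s * N) - F y) (l y ^ (N - 1) - h y) y := by
        intro y hy
        rw [interior_Icc] at hy
        have hy' : y ∈ Set.Ioo 0 D' := ⟨hy.1, by linarith [hy.2]⟩
        exact (hlder y ((hgpos y hy').trans_le (hleft y hy.1.le hy.2))).sub (milman_deriv hN H hy')
      refine monotoneOn_of_deriv_nonneg (convex_Icc _ _) ?_ ?_ ?_
      · exact hlcont.continuousOn.sub (hFc.mono (Set.Icc_subset_Icc le_rfl (by linarith)))
      · intro y hy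
        exact (hd y hy).differentiableAt.differentiableWithinAt
      · intro y hy
        rw [(hd y hy).deriv]
        rw [interior_Icc] at hy
        have hy' : y ∈ Set.Ioo 0 D' := ⟨hy.1, by linarith [hy.2]⟩
        rw [hgh y hy']
        have := Real.rpow_le_rpow (hgpos y hy').le (hleft y hy.1.le hy.2) (z := N - 1) (by linarith)
        linarith
    have := hm (a := 0) (b := b) ⟨le_rfl, hb.le⟩ ⟨hb.le, le_rfl⟩ hb.le
    simp only [hlb] at this
    have hF0 : F 0 = 0 := by simp [hF]
    have : 0 ≤ l 0 ^ N / (s * N) := by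
      have : 0 ≤ l 0 := (hgnn 0 ⟨le_rfl, hD.le⟩).trans (hleft 0 le_rfl hb)
      positivity
    linarith
  have k2 : g x ^ N / (s * N) - g b ^ N / (s * N) ≤ F x - F b := by
    have hm : MonotoneOn (fun y => F y - l y ^ N / (s * N)) (Set.Icc b x) := by
      have hlp : ∀ y, b < y → 0 < l y := by
        intro y hy
        simp only [hl]
        have := mul_pos hspos (sub_pos.2 hy)
        linarith
      have hd : ∀ y ∈ interior (Set.Icc b x),
          HasDerivAt (fun y => F y - l y ^ N / (s * N)) (h y - l y ^ (N - 1)) y := by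
        intro y hy
        rw [interior_Icc] at hy
        have hy' : y ∈ Set.Ioo 0 D' := ⟨by linarith [hy.1], by linarith [hy.2]⟩
        exact (milman_deriv hN H hy').sub (hlder y (hlp y hy.1))
      refine monotoneOn_of_deriv_nonneg (convex_Icc _ _) ?_ ?_ ?_
      · exact (hFc.mono (Set.Icc_subset_Icc hb.le hx.le)).sub hlcont.continuousOn
      · intro y hy
        exact (hd y hy).differentiableAt.differentiableWithinAt
      · intro y hy
        rw [(hd y hy).deriv]
        rw [interior_Icc] at hy
        have hy' : y ∈ Set.Ioo 0 D' := ⟨by linarith [hy.1], by linarith [hy.2]⟩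
        rw [hgh y hy']
        have := Real.rpow_le_rpow (hlp y hy.1).le (hright y hy.1 hy.2) (z := N - 1) (by linarith)
        linarith
    have := hm (a := b) (b := x) ⟨le_rfl, hbx.le⟩ ⟨hbx.le, le_rfl⟩ hbx.le
    simp only [hlb, hlx] at this
    linarith
  have hsN : 0 < s * N := mul_pos hspos (by linarith)
  rw [le_div_iff₀ hsN] at k1
  rw [← sub_div, div_le_iff₀ hsN] at k2
  have h4 : g b ^ N ≤ g x ^ N := Real.rpow_le_rpow hgb.le hs.le (by linarith)
  have h5 : 0 < g b ^ N := Real.rpow_pos_of_pos hgb _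
  have h6 : (g x ^ N - g b ^ N) * F b ≤ (F x - F b) * g b ^ N := by
    calc (g x ^ N - g b ^ N) * F b ≤ (F x - F b) * (s * N) * F b :=
          mul_le_mul_of_nonneg_right k2 hFb.le
      _ = (F x - F b) * (F b * (s * N)) := by ring
      _ ≤ _ := mul_le_mul_of_nonneg_left k1 (by linarith)
  linarith

/-- The core one-sided estimate. -/
lemma milman_core {N D' : ℝ} (hN : 1 < N) {h : ℝ → ℝ} (hD : 0 < D')
    (H : IsProbCDDensity N D' h) {b : ℝ} (hb : 0 < b) (hbD : b < D') :
    N * ((∫ t in (0:ℝ)..b, h t) ^ (1 - 1 / N) - ∫ t in (0:ℝ)..b, h t) ≤ D' * h b := by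
  set F : ℝ → ℝ := fun y => ∫ t in (0:ℝ)..y, h t with hF
  change N * (F b ^ (1 - 1 / N) - F b) ≤ D' * h b
  have hN0 : N ≠ 0 := by linarith
  have hN1 : N - 1 ≠ 0 := by linarith
  have hFpos : ∀ y, 0 < y → y ≤ D' → 0 < F y := fun y h1 h2 => milman_Fpos H le_rfl h1 h2
  have hhb := H.1.2.1 b ⟨hb, hbD⟩
  set c := h b * F b ^ (1 / N - 1) / N with hc
  have key : ∀ x ∈ interior (Set.Icc b D'), deriv (fun y => F y ^ (1 / N)) x ≤ c ∧
      DifferentiableAt ℝ (fun y => F y ^ (1 / N)) x := by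
    intro x hx
    rw [interior_Icc] at hx
    have hx' : x ∈ Set.Ioo 0 D' := ⟨by linarith [hx.1], hx.2⟩
    have hFx := hFpos x hx'.1 hx'.2.le
    have hFb := hFpos b hb hbD.le
    have hd := (milman_deriv hN H hx').rpow_const (p := 1 / N) (Or.inl hFx.ne')
    refine ⟨?_, hd.differentiableAt⟩
    change HasDerivAt (fun y => F y ^ (1 / N)) (h x * (1 / N) * F x ^ (1 / N - 1)) x at hd
    rw [hd.deriv, hc]
    have hhx := H.1.2.1 x hx'
    have r := milman_ratio hN hD H hb hx.1 hx.2
    change (h x ^ (1 / (N - 1))) ^ N * F b ≤ (h b ^ (1 / (N - 1))) ^ N * F x at r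
    have e : ∀ u v : ℝ, 0 < u → 0 < v →
        ((u ^ (1 / (N - 1))) ^ N * v) ^ ((N - 1) / N) = u * v ^ (1 - 1 / N) := by
      intro u v hu hv
      rw [Real.mul_rpow (by positivity) hv.le, ← Real.rpow_mul hu.le, ← Real.rpow_mul hu.le]
      have e1 : 1 / (N - 1) * N * ((N - 1) / N) = 1 := by field_simp
      have e2 : (N - 1) / N = 1 - 1 / N := by field_simp
      rw [e1, e2, Real.rpow_one]
    have r2 := Real.rpow_le_rpow (by positivity) r (z := (N - 1) / N)
      (div_nonneg (by linarith) (by linarith))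
    rw [e _ _ hhx hFb, e _ _ hhb hFx] at r2
    have n1 : ∀ v : ℝ, 0 < v → v ^ (1 / N - 1) = (v ^ (1 - 1 / N))⁻¹ := by
      intro v hv
      rw [← Real.rpow_neg hv.le]; congr 1; ring
    rw [n1 _ hFx, n1 _ hFb]
    have p1 : 0 < F x ^ (1 - 1 / N) := Real.rpow_pos_of_pos hFx _
    have p2 : 0 < F b ^ (1 - 1 / N) := Real.rpow_pos_of_pos hFb _
    have : h x * (F x ^ (1 - 1 / N))⁻¹ ≤ h b * (F b ^ (1 - 1 / N))⁻¹ := by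
      rw [← div_eq_mul_inv, ← div_eq_mul_inv, div_le_div_iff₀ p1 p2]; exact r2
    calc h x * (1 / N) * (F x ^ (1 - 1 / N))⁻¹ = h x * (F x ^ (1 - 1 / N))⁻¹ / N := by ring
      _ ≤ _ := by gcongr
  have hFb := hFpos b hb hbD.le
  have m := Convex.image_sub_le_mul_sub_of_deriv_le (convex_Icc b D')
    (f := fun y => F y ^ (1 / N)) (C := c)
    (((milman_Fcont hD H).mono (Set.Icc_subset_Icc hb.le le_rfl)).rpow_const
      (fun x _ => Or.inr (by have : 0 < N := by linarith
                             positivity)))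
    (fun x hx => (key x hx).2.differentiableWithinAt) (fun x hx => (key x hx).1)
    b ⟨le_rfl, hbD.le⟩ D' ⟨hbD.le, le_rfl⟩ hbD.le
  have hF1 : F D' = 1 := milman_Fone hD H
  simp only [hF1, Real.one_rpow] at m
  have hcpos : 0 ≤ c := by
    rw [hc]; have : 0 < N := by linarith
    positivity
  have m2 : 1 - F b ^ (1 / N) ≤ c * D' := m.trans (by nlinarith)
  have p2 : 0 < F b ^ (1 - 1 / N) := Real.rpow_pos_of_pos hFb _
  have q1 : F b ^ (1 - 1 / N) * F b ^ (1 / N) = F b := by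
    rw [← Real.rpow_add hFb]; simp
  have q2 : F b ^ (1 - 1 / N) * F b ^ (1 / N - 1) = 1 := by
    rw [← Real.rpow_add hFb]; simp
  have m3 := mul_le_mul_of_nonneg_left m2 p2.le
  have q3 : F b ^ (1 - 1 / N) * (c * D') = D' * h b / N := by
    calc F b ^ (1 - 1 / N) * (c * D') = (F b ^ (1 - 1 / N) * F b ^ (1 / N - 1)) * (D' * h b / N) := by
          rw [hc]; ring
      _ = _ := by rw [q2, one_mul]
  rw [q3, mul_sub, q1, le_div_iff₀ (by linarith)] at m3
  linarith

lemma milman_reflect {N D' : ℝ} {h : ℝ → ℝ} (hD : 0 < D') (H : IsProbCDDensity N D' h) :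
    IsProbCDDensity N D' (fun x => h (D' - x)) := by
  refine ⟨⟨?_, ?_, ?_⟩, ?_⟩
  · intro x hx; exact H.1.1 _ ⟨by linarith [hx.2], by linarith [hx.1]⟩
  · intro x hx; exact H.1.2.1 _ ⟨by linarith [hx.2], by linarith [hx.1]⟩
  · refine ⟨convex_Icc _ _, ?_⟩
    intro x hx y hy p q hp hq hpq
    have := H.1.2.2.2 (x := D' - x) (y := D' - y) ⟨by linarith [hx.2], by linarith [hx.1]⟩
      ⟨by linarith [hy.2], by linarith [hy.1]⟩ hp hq hpq
    have e : p • (D' - x) + q • (D' - y) = D' - (p • x + q • y) := by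
      simp only [smul_eq_mul]
      linear_combination D' * hpq
    rw [e] at this
    exact this
  · rw [integral_Icc_eq_integral_Ioc, ← intervalIntegral.integral_of_le hD.le,
      intervalIntegral.integral_comp_sub_left (fun x => h x)]
    simpa using milman_Fone hD H

lemma milman_core' {N D' : ℝ} (hN : 1 < N) {h : ℝ → ℝ} (hD : 0 < D')
    (H : IsProbCDDensity N D' h) {a : ℝ} (ha : 0 < a) (haD : a < D') :
    N * ((1 - ∫ t in (0:ℝ)..a, h t) ^ (1 - 1 / N) - (1 - ∫ t in (0:ℝ)..a, h t)) ≤ D' * h a := by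
  have := milman_core hN hD (milman_reflect hD H) (b := D' - a) (by linarith) (by linarith)
  rw [intervalIntegral.integral_comp_sub_left (fun x => h x)] at this
  have e := milman_Fsub H (x := a) (y := D') ⟨ha.le, haD.le⟩ ⟨hD.le, le_rfl⟩
  rw [milman_Fone hD H] at e
  simp only [sub_sub_cancel, sub_zero] at this
  rw [← e] at this
  exact this

lemma milman_G {N : ℝ} (hN : 1 < N) {w v : ℝ} (hw : 0 < w) (hwv : w ≤ v) (hv : v ≤ 1 / 2)
    (hw2 : w ^ (1 - 1 / N) ≤ (1 / 2 : ℝ) ^ (1 - 1 / N) - 1 / 2) :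
    w ^ (1 - 1 / N) - w ≤ v ^ (1 - 1 / N) - v := by
  have hN' : 1 / N < 1 := by rw [div_lt_one (by linarith)]; exact hN
  have hN'' : 0 < 1 / N := by have : 0 < N := by linarith
                              positivity
  have hc : ConcaveOn ℝ (Set.Ici (0:ℝ)) (fun v : ℝ => v ^ (1 - 1 / N) - v) :=
    (Real.concaveOn_rpow (by linarith) (by linarith)).sub (convexOn_id (convex_Ici 0))
  have := hc.min_le_of_mem_Icc (x := w) (y := 1 / 2) (z := v) hw.le
    (by norm_num) ⟨hwv, hv⟩
  rcases min_le_iff.1 this with h | h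
  · exact h
  · linarith

/-- Estimate for one component. -/
lemma milman_comp {N D' : ℝ} (hN : 1 < N) {h : ℝ → ℝ} (hD : 0 < D')
    (H : IsProbCDDensity N D' h) {a b : ℝ} (ha : 0 ≤ a) (hab : a < b) (hb : b ≤ D')
    (hw4 : (∫ t in a..b, h t) ≤ 1 / 4)
    (hw2 : (∫ t in a..b, h t) ^ (1 - 1 / N) ≤ (1 / 2 : ℝ) ^ (1 - 1 / N) - 1 / 2) :
    N * ((∫ t in a..b, h t) ^ (1 - 1 / N) - ∫ t in a..b, h t) ≤
      D' * ((if a < b ∧ a ≠ 0 then h a else 0) + (if a < b ∧ b ≠ D' then h b else 0)) := by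
  have hw := milman_Fpos H ha hab hb
  have hs := milman_Fsub H (x := a) (y := b) ⟨ha, by linarith⟩ ⟨by linarith, hb⟩
  by_cases ha0 : a = 0
  · subst ha0
    by_cases hbD : b = D'
    · subst hbD
      rw [milman_Fone hD H] at hw4
      norm_num at hw4
    · have := milman_core hN hD H (b := b) hab (lt_of_le_of_ne hb hbD)
      simpa [hab, hbD] using this
  have ha' : 0 < a := lt_of_le_of_ne ha (Ne.symm ha0)
  have haD : a < D' := by linarith
  have hha := H.1.2.1 a ⟨ha', haD⟩
  by_cases hbD : b = D'
  · subst hbD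
    have := milman_core' hN hD H ha' haD
    rw [milman_Fone hD H] at hs
    rw [hs] at this
    simpa [hab, ha0] using this
  have hbD' : b < D' := lt_of_le_of_ne hb hbD
  have hb0 : 0 < b := by linarith
  have hhb := H.1.2.1 b ⟨hb0, hbD'⟩
  simp only [hab, ha0, hbD, ne_eq, not_false_eq_true, and_self, if_true]
  set w := ∫ t in a..b, h t with hwdef
  have hA := milman_Fpos H le_rfl ha' haD.le
  have hB1 := milman_Fpos H hb0.le hbD' le_rfl
  rw [← milman_Fsub H ⟨hb0.le, hb⟩ ⟨hD.le, le_rfl⟩, milman_Fone hD H] at hB1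
  have cA := milman_core hN hD H ha' haD
  have cA' := milman_core' hN hD H ha' haD
  have cB := milman_core hN hD H hb0 hbD'
  set A := ∫ t in (0:ℝ)..a, h t
  set B := ∫ t in (0:ℝ)..b, h t
  have n0 : 0 < N := by linarith
  have pa : 0 < D' * h a := mul_pos hD hha
  have pb : 0 < D' * h b := mul_pos hD hhb
  rw [mul_add]
  rcases le_total B (1 / 2) with c | c
  · have := milman_G hN hw (v := B) (by linarith) c hw2
    have := mul_le_mul_of_nonneg_left this n0.le
    linarith
  rcases le_total A (1 / 2) with c | c
  · have := milman_G hN hw (v := A) (by linarith) c hw2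
    have := mul_le_mul_of_nonneg_left this n0.le
    linarith
  · have := milman_G hN hw (v := 1 - A) (by linarith) (by linarith) hw2
    have := mul_le_mul_of_nonneg_left this n0.le
    linarith

/-- Corollary 4.3: sharp lower bound for the perimeter of interval sets with respect to a
probability `CD(0,N)` density: `P_h(E) ≥ (N/D) m_h(E)^{1-1/N} (1 - C m_h(E)^{1/N})`. -/
theorem milman_isoperimetric_estimate (N : ℝ) (hN : 1 < N) :
    ∃ C : ℝ, 0 < C ∧ ∃ wbar : ℝ, 0 < wbar ∧
      ∀ D D' : ℝ, 0 < D' → D' ≤ D →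
      ∀ h : ℝ → ℝ, IsProbCDDensity N D' h →
      ∀ E : Set ℝ, E ⊆ Set.Icc 0 D' →
      ∀ d : IntervalDecomp D' h E,
        0 < (∫ x in E, h x) → (∫ x in E, h x) ≤ wbar →
        (N / D) * (∫ x in E, h x) ^ (1 - 1 / N) *
          (1 - C * (∫ x in E, h x) ^ (1 / N)) ≤ d.perim := by
  have n0 : 0 < N := by linarith
  have hN' : 1 / N < 1 := by rw [div_lt_one (by linarith)]; exact hN
  have hN'' : 0 < 1 / N := by positivity
  have he : 0 < 1 - 1 / N := by linarith
  have hc : 0 < (1 / 2 : ℝ) ^ (1 - 1 / N) - 1 / 2 := by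
    have : (1 / 2 : ℝ) ^ (1:ℝ) < (1 / 2 : ℝ) ^ (1 - 1 / N) :=
      Real.rpow_lt_rpow_of_exponent_gt (by norm_num) (by norm_num) (by linarith)
    rw [Real.rpow_one] at this
    linarith
  set c := (1 / 2 : ℝ) ^ (1 - 1 / N) - 1 / 2 with hcdef
  refine ⟨1, one_pos, min (1 / 4) (c ^ (1 / (1 - 1 / N))), lt_min (by norm_num)
    (Real.rpow_pos_of_pos hc _), ?_⟩
  intro D D' hD hDD h H E hE d hw hwb
  set w := ∫ x in E, h x with hwdef
  have hD0 : 0 < D := by linarith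
  -- masses of the components
  have hEq : w = ∫ x in ⋃ i, Set.Ioo (d.a i) (d.b i), h x := by
    rw [hwdef, setIntegral_congr_set d.aeEq]
  have hsub : (⋃ i, Set.Ioo (d.a i) (d.b i)) ⊆ Set.Icc 0 D' := by
    refine Set.iUnion_subset fun i x hx => ?_
    exact ⟨(d.nonneg i).trans hx.1.le, hx.2.le.trans (d.le_top i)⟩
  have hdisj : Pairwise (Function.onFun Disjoint fun i => Set.Ioo (d.a i) (d.b i)) := by
    intro i j hij
    rw [Function.onFun, Set.disjoint_left]
    intro x hx hy
    rcases d.sep i j hij with k | k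
    · linarith [hx.2, hy.1]
    · linarith [hx.1, hy.2]
  have hIntble := (milman_intble H).mono_set hsub
  have hsum := hasSum_integral_iUnion (fun i => measurableSet_Ioo) hdisj hIntble
  rw [← hEq] at hsum
  have hI : ∀ i, ∫ x in Set.Ioo (d.a i) (d.b i), h x = ∫ x in (d.a i)..(d.b i), h x := by
    intro i
    rw [intervalIntegral.integral_of_le (d.le i), integral_Ioc_eq_integral_Ioo]
  simp only [hI] at hsum
  have hterm0 : ∀ i, 0 ≤ ∫ x in (d.a i)..(d.b i), h x := by
    intro i
    rcases (d.le i).lt_or_eq with k | k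
    · exact (milman_Fpos H (d.nonneg i) k (d.le_top i)).le
    · rw [k]; simp
  have hle : ∀ i, ∫ x in (d.a i)..(d.b i), h x ≤ w := fun i =>
    le_hasSum hsum i (fun j _ => hterm0 j)
  have hper0 : ∀ i, 0 ≤ (if d.a i < d.b i ∧ d.a i ≠ 0 then h (d.a i) else 0) +
    (if d.a i < d.b i ∧ d.b i ≠ D' then h (d.b i) else 0) := by
    intro i
    have h1 := H.1.1 (d.a i) ⟨d.nonneg i, (d.le i).trans (d.le_top i)⟩
    have h2 := H.1.1 (d.b i) ⟨(d.nonneg i).trans (d.le i), d.le_top i⟩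
    refine add_nonneg ?_ ?_ <;> split_ifs <;> first | assumption | exact le_rfl
  have hwc : w ^ (1 - 1 / N) ≤ c := by
    have := Real.rpow_le_rpow hw.le (hwb.trans (min_le_right _ _)) he.le
    rwa [← Real.rpow_mul hc.le, one_div_mul_cancel he.ne', Real.rpow_one] at this
  have hcomp : ∀ i, (N * (w ^ (-(1 / N)) - 1)) * (∫ x in (d.a i)..(d.b i), h x) ≤
      D' * ((if d.a i < d.b i ∧ d.a i ≠ 0 then h (d.a i) else 0) +
    (if d.a i < d.b i ∧ d.b i ≠ D' then h (d.b i) else 0)) := by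
    intro i
    rcases (d.le i).lt_or_eq with k | k
    · have hp := milman_Fpos H (d.nonneg i) k (d.le_top i)
      refine le_trans ?_ (milman_comp hN hD H (d.nonneg i) k (d.le_top i)
        ((hle i).trans (hwb.trans (min_le_left _ _)))
        ((Real.rpow_le_rpow hp.le (hle i) he.le).trans hwc))
      set u := ∫ x in (d.a i)..(d.b i), h x
      have e1 : u ^ (1 - 1 / N) = u * u ^ (-(1 / N)) := by
        rw [sub_eq_add_neg, Real.rpow_add hp, Real.rpow_one]
      have e2 : w ^ (-(1 / N)) ≤ u ^ (-(1 / N)) :=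
        Real.rpow_le_rpow_of_nonpos hp (hle i) (by linarith)
      rw [e1]
      have := mul_le_mul_of_nonneg_left e2 (mul_pos n0 hp).le
      linarith
    · rw [k]; simp
  have htot := hasSum_le hcomp (hsum.mul_left _) (d.summablePerim.hasSum.mul_left D')
  change N * (w ^ (-(1 / N)) - 1) * w ≤ D' * d.perim at htot
  have hp0 : 0 ≤ d.perim := tsum_nonneg hper0
  have e1 : w ^ (1 - 1 / N) = w * w ^ (-(1 / N)) := by
    rw [sub_eq_add_neg, Real.rpow_add hw, Real.rpow_one]
  have e2 : w ^ (1 - 1 / N) * w ^ (1 / N) = w := by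
    rw [← Real.rpow_add hw]; simp
  have e3 : (N / D) * w ^ (1 - 1 / N) * (1 - 1 * w ^ (1 / N)) =
      (N * (w ^ (-(1 / N)) - 1) * w) / D := by
    calc (N / D) * w ^ (1 - 1 / N) * (1 - 1 * w ^ (1 / N))
        = N * (w ^ (1 - 1 / N) - w ^ (1 - 1 / N) * w ^ (1 / N)) / D := by ring
      _ = _ := by rw [e2, e1]; ring
  rw [e3, div_le_iff₀ hD0]
  have := mul_le_mul_of_nonneg_right hDD hp0
  linarith
end
end

section
/- Fix a real number N > 1 and L > 0. There exist constants w̄ > 0 and δ̄ > 0, depending only on N and L, such that for all D ≥ 3L, all D' ∈ (0, D], every probability CD(0,N) density h on [0,D'], and every interval set E ⊆ [0, L] with 0 < m_h(E) ≤ w̄ and Res_h^D(E) ≤ δ̄, the following hold: (i) there exist a ∈ [0, b(E)) and an at most countable family of open intervals (a_i, b_i) with a_i, b_i < a for all i, such that, up to a Lebesgue-null set, E = ⋃_i (a_i, b_i) ∪ (a, b(E)); (ii) h is strictly increasing on [0, b(E)]. -/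
open MeasureTheory
open scoped Classical

noncomputable section

/-- The essential supremum `b(E)` of a set `E ⊆ ℝ` with respect to Lebesgue measure. -/
def essSupSet (E : Set ℝ) : ℝ :=
  sInf {t : ℝ | volume (E ∩ Set.Ioi t) = 0}


/-- supergradient of a concave function at an interior point -/
lemma exists_supergrad {D' b : ℝ} {f : ℝ → ℝ} (hf : ConcaveOn ℝ (Set.Icc 0 D') f)
    (hb : 0 < b) (hbD : b < D') :
    ∃ k : ℝ, ∀ x ∈ Set.Icc (0:ℝ) D', f x ≤ f b + k * (x - b) := by
  have key : ∀ y ∈ Set.Ico (0:ℝ) b, ∀ x ∈ Set.Ioc b D',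
      (f x - f b) / (x - b) ≤ (f b - f y) / (b - y) := by
    intro y hy x hx
    exact hf.slope_anti_adjacent ⟨hy.1, hy.2.le.trans hbD.le⟩ ⟨hb.le.trans hx.1.le, hx.2⟩ hy.2 hx.1
  let S : Set ℝ := (fun y => (f b - f y) / (b - y)) '' Set.Ico (0:ℝ) b
  have hSne : S.Nonempty := ⟨_, 0, ⟨le_refl _, hb⟩, rfl⟩
  have hSbd : BddBelow S := by
    refine ⟨(f D' - f b) / (D' - b), ?_⟩
    rintro _ ⟨y, hy, rfl⟩
    exact key y hy D' ⟨hbD, le_refl _⟩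
  refine ⟨sInf S, fun x hx => ?_⟩
  rcases lt_trichotomy x b with h | h | h
  · have h1 : sInf S ≤ (f b - f x) / (b - x) := csInf_le hSbd ⟨x, ⟨hx.1, h⟩, rfl⟩
    rw [le_div_iff₀ (by linarith)] at h1
    linarith
  · subst h; simp
  · have h1 : (f x - f b) / (x - b) ≤ sInf S := by
      apply le_csInf hSne
      rintro _ ⟨y, hy, rfl⟩
      exact key y hy x ⟨h, hx.2⟩
    rw [div_le_iff₀ (by linarith)] at h1
    linarith

lemma integral_affine_rpow {N k φ b u v : ℝ} (hN : 1 < N) (hk : 0 < k) :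
    ∫ x in u..v, (φ + k * (x - b)) ^ (N - 1)
      = (φ + k * (v - b)) ^ N / (N * k) - (φ + k * (u - b)) ^ N / (N * k) := by
  apply intervalIntegral.integral_eq_sub_of_hasDerivAt
    (f := fun x => (φ + k * (x - b)) ^ N / (N * k))
  · intro x _
    have h1 : HasDerivAt (fun x : ℝ => φ + k * (x - b)) k x := by
      simpa using (((hasDerivAt_id x).sub_const b).const_mul k).const_add φ
    have h2 := (h1.rpow_const (p := N) (Or.inr hN.le)).div_const (N * k)
    have hN0 : 0 < N := by linarith
    have e : k * N * (φ + k * (x - b)) ^ (N - 1) / (N * k) = (φ + k * (x - b)) ^ (N - 1) := by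
      rw [div_eq_iff (by positivity)]
      ring
    rw [e] at h2
    exact h2
  · apply Continuous.intervalIntegrable
    exact (by fun_prop : Continuous fun x : ℝ => φ + k * (x - b)).rpow_const
      (fun x => Or.inr (by linarith))

lemma cd_integrable {N D' : ℝ} {h : ℝ → ℝ} (hh : IsProbCDDensity N D' h) :
    IntegrableOn h (Set.Icc 0 D') := by
  by_contra hc
  have := integral_undef hc
  rw [hh.2] at this
  exact one_ne_zero this

lemma left_mass {N D' b x0 : ℝ} {h : ℝ → ℝ} (hN : 1 < N) (hh : IsProbCDDensity N D' h)
    (hb : 0 < b) (hbx : b < x0) (hx0 : x0 < D')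
    (h5 : 5 * h b ^ (1 / (N - 1)) ≤ h x0 ^ (1 / (N - 1))) :
    ∫ x in (0:ℝ)..b, h x ≤ (5 * D' / 4 * h b / N) ^ (N / (N - 1)) := by
  have hN1 : 0 < N - 1 := by linarith
  have hD : 0 < D' := by linarith
  have hint := cd_integrable hh
  obtain ⟨⟨hnn, hpos, hconc⟩, hone⟩ := hh
  set f : ℝ → ℝ := fun x => h x ^ (1 / (N - 1)) with hf
  have hhf : ∀ x ∈ Set.Icc (0:ℝ) D', h x = f x ^ (N - 1) := by
    intro x hx
    simp only [hf]
    rw [← Real.rpow_mul (hnn x hx)]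
    field_simp
    simp
  have hfnn : ∀ x ∈ Set.Icc (0:ℝ) D', 0 ≤ f x := fun x hx => Real.rpow_nonneg (hnn x hx) _
  obtain ⟨k, hk⟩ := exists_supergrad hconc hb (hbx.trans hx0)
  have hbmem : b ∈ Set.Icc (0:ℝ) D' := ⟨hb.le, by linarith⟩
  have hx0mem : x0 ∈ Set.Icc (0:ℝ) D' := ⟨by linarith, by linarith⟩
  have hhb : 0 < h b := hpos b ⟨hb, by linarith⟩
  have hφ : 0 < f b := Real.rpow_pos_of_pos hhb _
  change 5 * f b ≤ f x0 at h5
  have hkx := hk x0 hx0mem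
  have hk4 : 4 * f b ≤ k * (x0 - b) := by linarith
  have hk0 : 0 < k := by
    by_contra hc
    have : k * (x0 - b) ≤ 0 := mul_nonpos_of_nonpos_of_nonneg (by linarith) (by linarith)
    linarith
  have hle : ∀ x ∈ Set.Icc (0:ℝ) D', h x ≤ (f b + k * (x - b)) ^ (N - 1) := by
    intro x hx
    rw [hhf x hx]
    exact Real.rpow_le_rpow (hfnn x hx) (hk x hx) hN1.le
  have hii : ∀ v ∈ Set.Icc (0:ℝ) D', IntervalIntegrable h volume 0 v := by
    intro v hv
    rw [intervalIntegrable_iff_integrableOn_Icc_of_le hv.1]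
    exact hint.mono_set (Set.Icc_subset_Icc_right hv.2)
  have hbound : ∀ v ∈ Set.Icc (0:ℝ) D', ∫ x in (0:ℝ)..v, h x ≤ (f b + k * (v - b)) ^ N / (N * k) := by
    intro v hv
    have h1 : ∫ x in (0:ℝ)..v, h x ≤ ∫ x in (0:ℝ)..v, (f b + k * (x - b)) ^ (N - 1) := by
      apply intervalIntegral.integral_mono_on hv.1 (hii v hv)
      · apply Continuous.intervalIntegrable
        exact (by fun_prop : Continuous fun x : ℝ => f b + k * (x - b)).rpow_const
          (fun x => Or.inr (by linarith))
      · intro x hx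
        exact hle x ⟨hx.1, hx.2.trans hv.2⟩
    rw [integral_affine_rpow hN hk0] at h1
    have h0 : (0:ℝ) ≤ f b + k * (0 - b) :=
      (hfnn 0 ⟨le_refl _, hD.le⟩).trans (hk 0 ⟨le_refl _, hD.le⟩)
    have : 0 ≤ (f b + k * (0 - b)) ^ N / (N * k) := by positivity
    linarith
  have hW := hbound b hbmem
  have h1 := hbound D' ⟨hD.le, le_refl _⟩
  rw [intervalIntegral.integral_of_le hD.le, ← integral_Icc_eq_integral_Ioc, hone] at h1
  simp only [sub_self, mul_zero, add_zero] at hW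
  set A := 5 * D' / 4 with hA
  have hApos : 0 < A := by positivity
  have hNk : N * k ≤ (k * A) ^ N := by
    rw [le_div_iff₀ (by positivity), one_mul] at h1
    refine h1.trans ?_
    have e1 : k * (x0 - b) ≤ k * D' := by gcongr; linarith
    have e2 : 0 ≤ k * (D' - b) := by apply mul_nonneg hk0.le; linarith
    apply Real.rpow_le_rpow (by linarith) _ (by linarith)
    rw [hA]
    nlinarith
  have hNA : N ≤ k ^ (N - 1) * A ^ N := by
    rw [Real.mul_rpow hk0.le hApos.le] at hNk
    have : k ^ N = k ^ (N - 1) * k := by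
      conv_rhs => rw [← Real.rpow_add_one hk0.ne' (N-1)]
      simp
    rw [this] at hNk
    have : N * k ≤ (k ^ (N - 1) * A ^ N) * k := by linarith
    exact le_of_mul_le_mul_right this hk0
  have hN2 : N ^ (1 / (N - 1)) ≤ k * A ^ (N / (N - 1)) := by
    have := Real.rpow_le_rpow (by linarith) hNA (by positivity : 0 ≤ 1 / (N - 1))
    rw [Real.mul_rpow (by positivity) (by positivity), ← Real.rpow_mul hk0.le,
      ← Real.rpow_mul hApos.le, mul_one_div_cancel hN1.ne', Real.rpow_one, mul_one_div] at this
    exact this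
  refine hW.trans ?_
  have hfN : f b ^ N = h b ^ (N / (N - 1)) := by
    simp only [hf]
    rw [← Real.rpow_mul hhb.le, one_div_mul_eq_div]
  have hNp : N ^ (N / (N - 1)) = N * N ^ (1 / (N - 1)) := by
    have : N / (N - 1) = 1 + 1 / (N - 1) := by field_simp; ring
    rw [this, Real.rpow_add (by linarith), Real.rpow_one]
  rw [hfN, Real.div_rpow (by positivity) (by linarith), Real.mul_rpow hApos.le hhb.le, hNp,
    div_le_div_iff₀ (by positivity) (by positivity)]
  have : 0 < h b ^ (N / (N - 1)) := by positivity
  calc h b ^ (N / (N - 1)) * (N * N ^ (1 / (N - 1)))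
      ≤ h b ^ (N / (N - 1)) * (N * (k * A ^ (N / (N - 1)))) := by gcongr
    _ = _ := by ring

lemma reflect_cd {N D' : ℝ} {h : ℝ → ℝ} (hD : 0 < D') (hh : IsProbCDDensity N D' h) :
    IsProbCDDensity N D' (fun x => h (D' - x)) := by
  obtain ⟨⟨hnn, hpos, hconc⟩, hone⟩ := hh
  refine ⟨⟨fun x hx => hnn _ ⟨by linarith [hx.2], by linarith [hx.1]⟩,
    fun x hx => hpos _ ⟨by linarith [hx.2], by linarith [hx.1]⟩, ⟨convex_Icc _ _, ?_⟩⟩, ?_⟩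
  · intro x hx y hy s t hs ht hst
    have := hconc.2 (x := D' - x) ⟨by linarith [hx.2], by linarith [hx.1]⟩
      (y := D' - y) ⟨by linarith [hy.2], by linarith [hy.1]⟩ hs ht hst
    have e : s • (D' - x) + t • (D' - y) = D' - (s • x + t • y) := by
      simp only [smul_eq_mul]; linear_combination D' * hst
    rw [e] at this
    exact this
  · rw [integral_Icc_eq_integral_Ioc, ← intervalIntegral.integral_of_le hD.le,
      intervalIntegral.integral_comp_sub_left (fun x => h x) D'] 
    rw [integral_Icc_eq_integral_Ioc, ← intervalIntegral.integral_of_le hD.le] at hone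
    simpa using hone

lemma right_mass {N D' b x0 : ℝ} {h : ℝ → ℝ} (hN : 1 < N) (hh : IsProbCDDensity N D' h)
    (hb : b < D') (hbx : x0 < b) (hx0 : 0 < x0)
    (h5 : 5 * h b ^ (1 / (N - 1)) ≤ h x0 ^ (1 / (N - 1))) :
    ∫ x in b..D', h x ≤ (5 * D' / 4 * h b / N) ^ (N / (N - 1)) := by
  have := left_mass (b := D' - b) (x0 := D' - x0) hN (reflect_cd (by linarith) hh)
    (by linarith) (by linarith) (by linarith) (by simpa using h5)
  rw [intervalIntegral.integral_comp_sub_left (fun x => h x) D'] at this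
  simpa using this

/-- a point of large density in the interior -/
lemma exists_big {N D' : ℝ} {h : ℝ → ℝ} (hD : 0 < D') (hh : IsProbCDDensity N D' h) :
    ∃ x0 ∈ Set.Ioo (0:ℝ) D', 1 ≤ D' * h x0 := by
  by_contra hc
  push Not at hc
  have hint := (cd_integrable hh).mono_set Set.Ioo_subset_Icc_self
  have hone := hh.2
  rw [integral_Icc_eq_integral_Ioo] at hone
  have hvol : volume (Set.Ioo 0 D') ≠ 0 := by simp [hD]
  have hvol' : volume (Set.Ioo 0 D') ≠ ⊤ := by simp
  obtain ⟨x, hx, hx2⟩ := exists_setAverage_le hvol hvol' hint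
  rw [setAverage_eq, hone] at hx2
  have := hc x hx
  simp [hD.le] at hx2
  rw [inv_le_iff_one_le_mul₀ hD] at hx2
  linarith

/-- strict monotonicity to the left of a point with a bigger value further right -/
lemma strictMono_left {N D' b x0 : ℝ} {h : ℝ → ℝ} (hN : 1 < N) (hh : IsCDDensity N D' h)
    (hb : 0 < b) (hbx : b < x0) (hx0 : x0 < D') (hlt : h b < h x0) :
    StrictMonoOn h (Set.Icc 0 b) := by
  have hN1 : 0 < N - 1 := by linarith
  obtain ⟨hnn, hpos, hconc⟩ := hh
  intro x hx y hy hxy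
  have hmem : ∀ z, 0 ≤ z → z ≤ x0 → z ∈ Set.Icc (0:ℝ) D' := fun z h1 h2 => ⟨h1, by linarith⟩
  have hfb : h b ^ (1 / (N - 1)) < h x0 ^ (1 / (N - 1)) :=
    Real.rpow_lt_rpow (hnn _ (hmem b hb.le hbx.le)) hlt (by positivity)
  have hyx0 : h y ^ (1 / (N - 1)) < h x0 ^ (1 / (N - 1)) := by
    rcases hy.2.lt_or_eq with h1 | h1
    · have := hconc.slope_anti_adjacent (hmem y hy.1 (by linarith)) (hmem x0 (by linarith) le_rfl)
        h1 hbx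
      have h2 : 0 < (h x0 ^ (1 / (N - 1)) - h b ^ (1 / (N - 1))) / (x0 - b) :=
        div_pos (by linarith) (by linarith)
      have h3 := h2.trans_le this
      rw [lt_div_iff₀ (by linarith)] at h3
      linarith
    · rw [h1]; exact hfb
  have := hconc.slope_anti_adjacent (hmem x hx.1 (by linarith [hx.2])) (hmem x0 (by linarith) le_rfl)
        hxy (lt_of_le_of_lt hy.2 hbx)
  have h2 : 0 < (h x0 ^ (1 / (N - 1)) - h y ^ (1 / (N - 1))) / (x0 - y) :=
    div_pos (by linarith) (by linarith [hy.2])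
  have h3 := h2.trans_le this
  rw [lt_div_iff₀ (by linarith)] at h3
  have h4 : h x ^ (1 / (N - 1)) < h y ^ (1 / (N - 1)) := by linarith
  exact (Real.rpow_lt_rpow_iff (hnn _ (hmem x hx.1 (by linarith [hx.2])))
    (hnn _ (hmem y hy.1 (by linarith [hy.2]))) (by positivity)).1 h4

/-- points of small density right of `x0` are near the right end -/
lemma near_right {N D' a x0 : ℝ} {h : ℝ → ℝ} (hh : IsCDDensity N D' h)
    (hx0 : 0 < x0) (hxa : x0 < a) (ha : a < D')
    (h5 : 5 * h a ^ (1 / (N - 1)) ≤ h x0 ^ (1 / (N - 1))) : 4 / 5 * D' ≤ a := by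
  obtain ⟨hnn, hpos, hconc⟩ := hh
  have h0 : 0 ≤ h D' ^ (1 / (N - 1)) := Real.rpow_nonneg (hnn _ ⟨by linarith, le_rfl⟩) _
  have hp : 0 < h a ^ (1 / (N - 1)) := Real.rpow_pos_of_pos (hpos _ ⟨by linarith, ha⟩) _
  have := hconc.slope_anti_adjacent (x := x0) (y := a) (z := D') ⟨by linarith, by linarith⟩
    ⟨by linarith, le_rfl⟩ hxa ha
  rw [div_le_div_iff₀ (by linarith) (by linarith)] at this
  set u := h a ^ (1 / (N - 1))
  by_contra hc
  push Not at hc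
  nlinarith [mul_nonneg h0 (by linarith : 0 ≤ a - x0), mul_pos hp (by linarith : 0 < D' - a),
    mul_pos hp (by linarith : 0 < a - x0), mul_le_mul_of_nonneg_right h5 (by linarith : 0 ≤ D' - a)]

/-- the summand of the perimeter -/
def perimTerm {D' : ℝ} {h : ℝ → ℝ} {E : Set ℝ} (d : IntervalDecomp D' h E) (i : ℕ) : ℝ :=
  (if d.a i < d.b i ∧ d.a i ≠ 0 then h (d.a i) else 0) +
  (if d.a i < d.b i ∧ d.b i ≠ D' then h (d.b i) else 0)

section terms
variable {N D' : ℝ} {h : ℝ → ℝ} {E : Set ℝ}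

lemma a_term_nonneg (hh : IsCDDensity N D' h) (d : IntervalDecomp D' h E) (i : ℕ) :
    0 ≤ (if d.a i < d.b i ∧ d.a i ≠ 0 then h (d.a i) else 0) := by
  split_ifs
  · exact hh.1 _ ⟨d.nonneg i, (d.le i).trans (d.le_top i)⟩
  · exact le_rfl

lemma b_term_nonneg (hh : IsCDDensity N D' h) (d : IntervalDecomp D' h E) (i : ℕ) :
    0 ≤ (if d.a i < d.b i ∧ d.b i ≠ D' then h (d.b i) else 0) := by
  split_ifs
  · exact hh.1 _ ⟨(d.nonneg i).trans (d.le i), d.le_top i⟩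
  · exact le_rfl

lemma perimTerm_nonneg (hh : IsCDDensity N D' h) (d : IntervalDecomp D' h E) (i : ℕ) :
    0 ≤ perimTerm d i := add_nonneg (a_term_nonneg hh d i) (b_term_nonneg hh d i)

lemma perimTerm_le (hh : IsCDDensity N D' h) (d : IntervalDecomp D' h E) (i : ℕ) :
    perimTerm d i ≤ d.perim :=
  d.summablePerim.le_tsum i (fun j _ => perimTerm_nonneg hh d j)

lemma a_le_perimTerm (hh : IsCDDensity N D' h) (d : IntervalDecomp D' h E) {i : ℕ}
    (hi : d.a i < d.b i) (h0 : d.a i ≠ 0) : h (d.a i) ≤ perimTerm d i := by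
  have := b_term_nonneg hh d i
  unfold perimTerm
  rw [if_pos ⟨hi, h0⟩]; linarith

lemma b_le_perimTerm (hh : IsCDDensity N D' h) (d : IntervalDecomp D' h E) {i : ℕ}
    (hi : d.a i < d.b i) (h0 : d.b i ≠ D') : h (d.b i) ≤ perimTerm d i := by
  have := a_term_nonneg hh d i
  unfold perimTerm
  rw [if_pos (show d.a i < d.b i ∧ d.b i ≠ D' from ⟨hi, h0⟩)]; linarith

lemma mass_hasSum (hh : IsProbCDDensity N D' h) (d : IntervalDecomp D' h E) :
    HasSum (fun i => ∫ x in Set.Ioo (d.a i) (d.b i), h x) (∫ x in E, h x) := by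
  rw [setIntegral_congr_set d.aeEq]
  apply hasSum_integral_iUnion
  · exact fun i => measurableSet_Ioo
  · intro i j hij
    refine Set.disjoint_left.2 fun x hx hy => ?_
    rcases d.sep i j hij with h1 | h1
    · linarith [hx.2, hy.1]
    · linarith [hx.1, hy.2]
  · apply (cd_integrable hh).mono_set
    refine Set.iUnion_subset fun i x hx => ⟨?_, ?_⟩
    · linarith [d.nonneg i, hx.1]
    · linarith [d.le_top i, hx.2]

lemma mass_nonneg (hh : IsProbCDDensity N D' h) (d : IntervalDecomp D' h E) (i : ℕ) :
    0 ≤ ∫ x in Set.Ioo (d.a i) (d.b i), h x := by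
  apply setIntegral_nonneg measurableSet_Ioo
  intro x hx
  exact hh.1.1 x ⟨by linarith [d.nonneg i, hx.1], by linarith [d.le_top i, hx.2]⟩

end terms

lemma ii_of {N D' u v : ℝ} {h : ℝ → ℝ} (hh : IsProbCDDensity N D' h) (hu : 0 ≤ u) (huv : u ≤ v)
    (hv : v ≤ D') : IntervalIntegrable h volume u v := by
  rw [intervalIntegrable_iff_integrableOn_Icc_of_le huv]
  exact (cd_integrable hh).mono_set (Set.Icc_subset_Icc hu hv)

lemma ii_nonneg {N D' u v : ℝ} {h : ℝ → ℝ} (hh : IsProbCDDensity N D' h) (hu : 0 ≤ u)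
    (huv : u ≤ v) (hv : v ≤ D') : 0 ≤ ∫ x in u..v, h x :=
  intervalIntegral.integral_nonneg huv fun x hx => hh.1.1 x ⟨hu.trans hx.1, hx.2.trans hv⟩

/-- Core estimate: no interval contains `x0`, and each one satisfies the isoperimetric bound. -/
lemma core {N D' x0 w W : ℝ} {h : ℝ → ℝ} {E : Set ℝ} (hN : 1 < N)
    (hh : IsProbCDDensity N D' h) (d : IntervalDecomp D' h E) (hx0 : x0 ∈ Set.Ioo 0 D')
    (h5 : ∀ t ∈ Set.Ioo 0 D', h t ≤ d.perim →
      5 * h t ^ (1 / (N - 1)) ≤ h x0 ^ (1 / (N - 1)))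
    (hw : (∫ x in E, h x) ≤ w)
    (hW : (5 * D' / 4 * d.perim / N) ^ (N / (N - 1)) ≤ W) (hwW : w + 2 * W < 1)
    (i : ℕ) (hi : d.a i < d.b i) :
    (d.b i < x0 ∨ x0 < d.a i) ∧
      ∫ x in Set.Ioo (d.a i) (d.b i), h x ≤ (5 * D' / 4 * perimTerm d i / N) ^ (N / (N - 1)) := by
  have hN1 : 0 < N - 1 := by linarith
  have hD : 0 < D' := hx0.1.trans hx0.2
  have hpe : 0 ≤ N / (N - 1) := by positivity
  have hP := perimTerm_le hh.1 d i
  have ha := d.nonneg i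
  have hb := d.le_top i
  have hpn := perimTerm_nonneg hh.1 d i
  have hx0pos := Real.rpow_pos_of_pos (hh.1.2.1 x0 hx0) (1 / (N - 1))
  have hmi : ∫ x in Set.Ioo (d.a i) (d.b i), h x = ∫ x in (d.a i)..(d.b i), h x := by
    rw [intervalIntegral.integral_of_le hi.le, integral_Ioc_eq_integral_Ioo]
  have hm_le : ∫ x in Set.Ioo (d.a i) (d.b i), h x ≤ w := by
    have hs := mass_hasSum hh d
    exact (le_hasSum hs i fun j _ => mass_nonneg hh d j).trans hw
  have hne : ∀ t ∈ Set.Ioo 0 D', h t ≤ d.perim → t ≠ x0 := by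
    rintro t ht h1 rfl
    have := h5 t ht h1
    linarith
  have hmono : ∀ s r : ℝ, 0 ≤ s → s ≤ r →
      (5 * D' / 4 * s / N) ^ (N / (N - 1)) ≤ (5 * D' / 4 * r / N) ^ (N / (N - 1)) := by
    intro s r h0 h1
    apply Real.rpow_le_rpow (by positivity) _ hpe
    gcongr
  have hW0 : 0 ≤ W := by
    refine le_trans (Real.rpow_nonneg ?_ _) hW
    have := hpn.trans hP
    positivity
  -- left mass bound
  have hL : ∀ t ∈ Set.Ioo 0 D', h t ≤ perimTerm d i → t ≤ x0 →
      ∫ x in (0:ℝ)..t, h x ≤ (5 * D' / 4 * perimTerm d i / N) ^ (N / (N - 1)) := by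
    intro t ht h1 h2
    have h3 := h1.trans hP
    exact (left_mass hN hh ht.1 (lt_of_le_of_ne h2 (hne t ht h3)) hx0.2 (h5 t ht h3)).trans
      (hmono _ _ (hh.1.1 t ⟨ht.1.le, ht.2.le⟩) h1)
  have hR : ∀ t ∈ Set.Ioo 0 D', h t ≤ perimTerm d i → x0 ≤ t →
      ∫ x in t..D', h x ≤ (5 * D' / 4 * perimTerm d i / N) ^ (N / (N - 1)) := by
    intro t ht h1 h2
    have h3 := h1.trans hP
    exact (right_mass hN hh ht.2 (lt_of_le_of_ne h2 (hne t ht h3).symm) hx0.1 (h5 t ht h3)).trans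
      (hmono _ _ (hh.1.1 t ⟨ht.1.le, ht.2.le⟩) h1)
  have hsplit : (∫ x in (0:ℝ)..(d.a i), h x) + (∫ x in (d.a i)..(d.b i), h x)
      + (∫ x in (d.b i)..D', h x) = 1 := by
    rw [intervalIntegral.integral_add_adjacent_intervals
        (ii_of hh le_rfl ha (hi.le.trans hb)) (ii_of hh ha hi.le hb),
      intervalIntegral.integral_add_adjacent_intervals
        (ii_of hh le_rfl (ha.trans hi.le) hb) (ii_of hh (ha.trans hi.le) hb le_rfl),
      intervalIntegral.integral_of_le hD.le, ← integral_Icc_eq_integral_Ioc, hh.2]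
  have n1 := ii_nonneg hh le_rfl ha (hi.le.trans hb)
  have n3 := ii_nonneg hh (ha.trans hi.le) hb le_rfl
  have hPW := (hmono _ _ hpn hP).trans hW
  rcases le_or_gt (d.b i) x0 with hbx | hbx
  · have hbD : d.b i ≠ D' := by linarith [hx0.2]
    have hbm : d.b i ∈ Set.Ioo 0 D' := ⟨by linarith, by linarith [hx0.2]⟩
    have hbl := b_le_perimTerm hh.1 d hi hbD
    refine ⟨Or.inl (lt_of_le_of_ne hbx (hne _ hbm (hbl.trans hP))), ?_⟩
    rw [hmi]
    have := hL _ hbm hbl hbx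
    rw [← intervalIntegral.integral_add_adjacent_intervals
        (ii_of hh le_rfl ha (hi.le.trans hb)) (ii_of hh ha hi.le hb)] at this
    linarith
  rcases le_or_gt x0 (d.a i) with hax | hax
  · have haD : d.a i ≠ 0 := by linarith [hx0.1]
    have ham : d.a i ∈ Set.Ioo 0 D' := ⟨by linarith [hx0.1], by linarith⟩
    have hal := a_le_perimTerm hh.1 d hi haD
    refine ⟨Or.inr (lt_of_le_of_ne hax (hne _ ham (hal.trans hP)).symm), ?_⟩
    rw [hmi]
    have := hR _ ham hal hax
    rw [← intervalIntegral.integral_add_adjacent_intervals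
        (ii_of hh ha hi.le hb) (ii_of hh (ha.trans hi.le) hb le_rfl)] at this
    linarith
  exfalso
  have b1 : ∫ x in (0:ℝ)..(d.a i), h x ≤ W := by
    by_cases h0 : d.a i = 0
    · rw [h0]; simpa using hW0
    · exact (hL _ ⟨lt_of_le_of_ne ha (Ne.symm h0), by linarith⟩
        (a_le_perimTerm hh.1 d hi h0) hax.le).trans hPW
  have b2 : ∫ x in (d.b i)..D', h x ≤ W := by
    by_cases h0 : d.b i = D'
    · rw [h0]; simpa using hW0
    · exact (hR _ ⟨by linarith, lt_of_le_of_ne hb h0⟩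
        (b_le_perimTerm hh.1 d hi h0) hbx.le).trans hPW
  rw [hmi] at hm_le
  linarith

/-- Summing up the isoperimetric bound. -/
lemma total_bound {N D' : ℝ} {h : ℝ → ℝ} {E : Set ℝ} (hN : 1 < N) (hD : 0 < D')
    (hh : IsProbCDDensity N D' h) (d : IntervalDecomp D' h E)
    (hc : ∀ i, d.a i < d.b i →
      ∫ x in Set.Ioo (d.a i) (d.b i), h x ≤ (5 * D' / 4 * perimTerm d i / N) ^ (N / (N - 1))) :
    (∫ x in E, h x) ≤ (5 * D' / 4 * d.perim / N) ^ (N / (N - 1)) := by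
  have hN1 : 0 < N - 1 := by linarith
  set p := N / (N - 1) with hp
  have hp1 : 0 < p - 1 := by
    have : p - 1 = 1 / (N - 1) := by rw [hp]; field_simp; ring
    rw [this]; positivity
  have hP0 : 0 ≤ d.perim := (perimTerm_nonneg hh.1 d 0).trans (perimTerm_le hh.1 d 0)
  set A := 5 * D' / 4 with hA
  have hApos : 0 < A := by positivity
  have hsum : HasSum (fun i => (A / N) ^ p * d.perim ^ (p - 1) * perimTerm d i)
      ((A / N) ^ p * d.perim ^ (p - 1) * d.perim) :=
    d.summablePerim.hasSum.mul_left _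
  have hle : ∀ i, ∫ x in Set.Ioo (d.a i) (d.b i), h x ≤
      (A / N) ^ p * d.perim ^ (p - 1) * perimTerm d i := by
    intro i
    have hpn := perimTerm_nonneg hh.1 d i
    by_cases hi : d.a i < d.b i
    · refine (hc i hi).trans ?_
      rw [mul_div_right_comm, Real.mul_rpow (by positivity) hpn, mul_assoc]
      gcongr
      rcases hpn.eq_or_lt with h0 | h0
      · rw [← h0, Real.zero_rpow (by linarith)]; simp
      · have : perimTerm d i ^ p = perimTerm d i ^ (p - 1) * perimTerm d i := by
          rw [← Real.rpow_add_one h0.ne']; simp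
        rw [this]
        gcongr
        exact perimTerm_le hh.1 d i
    · rw [Set.Ioo_eq_empty hi]
      simp only [setIntegral_empty]
      positivity
  have h1 := hasSum_le hle (mass_hasSum hh d) hsum
  refine h1.trans ?_
  rw [mul_div_right_comm, Real.mul_rpow (by positivity) hP0, mul_assoc]
  gcongr
  rcases hP0.eq_or_lt with h0 | h0
  · rw [← h0]; simp [Real.zero_rpow (by linarith : p ≠ 0)]
  · rw [← Real.rpow_add_one h0.ne']; simp

/-- The structural conclusion, once the rightmost interval has been found. -/
lemma structure_aux {D' : ℝ} {h : ℝ → ℝ} {E : Set ℝ} (d : IntervalDecomp D' h E) (k : ℕ)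
    (hk : d.a k < d.b k) (hmax : ∀ i, d.a i < d.b i → d.b i ≤ d.b k) :
    essSupSet E = d.b k ∧ ∃ a : ℝ, 0 ≤ a ∧ a < d.b k ∧
          ∃ c e : ℕ → ℝ, (∀ i, c i ≤ e i ∧ e i < a) ∧
            E =ᵐ[volume] (((⋃ i, Set.Ioo (c i) (e i)) ∪ Set.Ioo a (d.b k) : Set ℝ)) := by
  constructor
  · have : {t : ℝ | volume (E ∩ Set.Ioi t) = 0} = Set.Ici (d.b k) := by
      ext t
      have h1 : volume (E ∩ Set.Ioi t) = volume ((⋃ i, Set.Ioo (d.a i) (d.b i)) ∩ Set.Ioi t) :=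
        measure_congr (d.aeEq.inter (ae_eq_refl _))
      simp only [Set.mem_ofPred_eq, Set.mem_Ici]
      rw [h1]
      constructor
      · intro h0
        by_contra hc
        push Not at hc
        have hsub : Set.Ioo (max t (d.a k)) (d.b k) ⊆
            (⋃ i, Set.Ioo (d.a i) (d.b i)) ∩ Set.Ioi t := by
          intro x hx
          exact ⟨Set.mem_iUnion.2 ⟨k, (le_max_right _ _).trans_lt hx.1, hx.2⟩,
            (le_max_left _ _).trans_lt hx.1⟩
        have h2 := measure_mono_null hsub h0
        rw [Real.volume_Ioo, ENNReal.ofReal_eq_zero] at h2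
        have := max_lt hc hk
        linarith
      · intro ht
        have : (⋃ i, Set.Ioo (d.a i) (d.b i)) ∩ Set.Ioi t = ∅ := by
          ext x
          simp only [Set.mem_inter_iff, Set.mem_iUnion, Set.mem_empty_iff_false, iff_false]
          rintro ⟨⟨i, hi⟩, hx⟩
          have := hmax i (hi.1.trans hi.2)
          have hx' : t < x := hx
          linarith [hi.2]
        rw [this]; simp
    rw [essSupSet, this, csInf_Ici]
  · set m := (d.a k + d.b k) / 2 with hm
    have hm1 : d.a k < m := by rw [hm]; linarith
    have hm2 : m < d.b k := by rw [hm]; linarith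
    refine ⟨m, (d.nonneg k).trans hm1.le, hm2,
      fun j => min (d.a j.unpair.1) (m - 1 / ((j.unpair.2 : ℝ) + 1)),
      fun j => min (d.b j.unpair.1) (m - 1 / ((j.unpair.2 : ℝ) + 1)), fun j => ⟨?_, ?_⟩, ?_⟩
    · exact min_le_min_right _ (d.le _)
    · refine (min_le_right _ _).trans_lt ?_
      have : 0 < 1 / ((j.unpair.2 : ℝ) + 1) := by positivity
      linarith
    · refine d.aeEq.trans ?_
      have hne : ∀ᵐ x : ℝ ∂volume, x ≠ m := by
        simp [ae_iff]
      filter_upwards [hne] with x hx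
      apply propext
      refine (?_ : x ∈ (⋃ i, Set.Ioo (d.a i) (d.b i)) ↔ x ∈ ((_ ∪ _ : Set ℝ)))
      simp only [Set.mem_union, Set.mem_iUnion, Set.mem_Ioo]
      constructor
      · rintro ⟨i, hi1, hi2⟩
        rcases lt_or_gt_of_ne hx with h1 | h1
        · left
          obtain ⟨n, hn⟩ := exists_nat_one_div_lt (sub_pos.2 h1)
          refine ⟨Nat.pair i n, ?_⟩
          simp only [Nat.unpair_pair]
          exact ⟨(min_le_left _ _).trans_lt hi1, lt_min hi2 (by linarith)⟩
        · right
          exact ⟨h1, hi2.trans_le (hmax i (hi1.trans hi2))⟩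
      · rintro (⟨j, hj1, hj2⟩ | ⟨h1, h2⟩)
        · refine ⟨j.unpair.1, ?_, hj2.trans_le (min_le_left _ _)⟩
          have := hj2.trans_le (min_le_right _ _)
          rcases min_lt_iff.1 hj1 with h3 | h3
          · exact h3
          · linarith
        · exact ⟨k, by linarith, h2⟩

/-- Lemma 5.5 (structure of almost optimal sets): if `m_h(E)` and `Res_h^D(E)` are small
enough, then, up to a null set, `E` is the union of a rightmost interval `(a, b(E))` together
with at most countably many intervals lying strictly to the left of `a`; moreover `h` is
strictly increasing on `[0, b(E)]`. -/
theorem structure_of_almost_optimal_sets (N L : ℝ) (hN : 1 < N) (hL : 0 < L) :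
    ∃ wbar : ℝ, 0 < wbar ∧ ∃ δbar : ℝ, 0 < δbar ∧
      ∀ D D' : ℝ, 3 * L ≤ D → D' ∈ Set.Ioc (0:ℝ) D →
      ∀ h : ℝ → ℝ, IsProbCDDensity N D' h →
      ∀ E : Set ℝ, E ⊆ Set.Icc 0 L →
      ∀ d : IntervalDecomp D' h E,
        0 < (∫ x in E, h x) → (∫ x in E, h x) ≤ wbar →
        D * d.perim / (N * (∫ x in E, h x) ^ (1 - 1 / N)) - 1 ≤ δbar →
        (∃ a : ℝ, 0 ≤ a ∧ a < essSupSet E ∧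
          ∃ c e : ℕ → ℝ, (∀ i, c i ≤ e i ∧ e i < a) ∧
            E =ᵐ[volume] (((⋃ i, Set.Ioo (c i) (e i)) ∪ Set.Ioo a (essSupSet E) : Set ℝ))) ∧
        StrictMonoOn h (Set.Icc 0 (essSupSet E)) := by
  have hN1 : 0 < N - 1 := by linarith
  set p := N / (N - 1) with hp
  have hppos : 0 < p := by positivity
  have hqpos : 0 < 1 - 1 / N := by
    have : 1 / N < 1 := by rw [div_lt_one (by linarith)]; exact hN
    linarith
  have hpq : p * (1 - 1 / N) = 1 := by rw [hp]; field_simp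
  set K : ℝ := 6 / 5 * N * 5 ^ (N - 1) with hK
  have hKpos : 0 < K := by positivity
  set T : ℝ := (3 / 2 : ℝ) ^ p with hT
  have hTpos : 0 < T := by positivity
  set w : ℝ := min ((1 / K) ^ p) (1 / (2 * (1 + 2 * T))) with hw
  have hwpos : 0 < w := lt_min (by positivity) (by positivity)
  have hw1 : K * w ^ (1 - 1 / N) ≤ 1 := by
    have h1 : w ^ (1 - 1 / N) ≤ ((1 / K) ^ p) ^ (1 - 1 / N) :=
      Real.rpow_le_rpow hwpos.le (min_le_left _ _) hqpos.le
    rw [← Real.rpow_mul (by positivity), hpq, Real.rpow_one, le_div_iff₀ hKpos] at h1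
    linarith
  have hw2 : w + 2 * (T * w) < 1 := by
    have h1 : w ≤ 1 / (2 * (1 + 2 * T)) := min_le_right _ _
    rw [le_div_iff₀ (by positivity)] at h1
    nlinarith
  refine ⟨w, hwpos, 1 / 5, by norm_num, ?_⟩
  intro D D' hDL hD' h hh E hEL d hm0 hmw hres
  obtain ⟨hD0, hDD⟩ := hD'
  have hDpos : 0 < D := by linarith
  set m := ∫ x in E, h x with hm
  have hmq : 0 < m ^ (1 - 1 / N) := by positivity
  have hDP : D * d.perim ≤ 6 / 5 * N * m ^ (1 - 1 / N) := by
    have h1 : D * d.perim / (N * m ^ (1 - 1 / N)) ≤ 6 / 5 := by linarith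
    rw [div_le_iff₀ (by positivity)] at h1
    linarith
  have hmqw : m ^ (1 - 1 / N) ≤ w ^ (1 - 1 / N) := Real.rpow_le_rpow hm0.le hmw hqpos.le
  have hP0 : 0 ≤ d.perim := (perimTerm_nonneg hh.1 d 0).trans (perimTerm_le hh.1 d 0)
  have hDP' : D' * d.perim ≤ 6 / 5 * N * w ^ (1 - 1 / N) :=
    (mul_le_mul_of_nonneg_right hDD hP0).trans (hDP.trans (by gcongr))
  obtain ⟨x0, hx0, hx1⟩ := exists_big hD0 hh
  have hhx0 : 0 < h x0 := hh.1.2.1 x0 hx0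
  have h5' : 5 ^ (N - 1) * d.perim ≤ h x0 := by
    have e1 : 5 ^ (N - 1) * (D' * d.perim) ≤ 5 ^ (N - 1) * (6 / 5 * N * w ^ (1 - 1 / N)) := by
      gcongr
    have e2 : 5 ^ (N - 1) * (6 / 5 * N * w ^ (1 - 1 / N)) = K * w ^ (1 - 1 / N) := by
      rw [hK]; ring
    have : D' * (5 ^ (N - 1) * d.perim) ≤ D' * h x0 := by linarith
    exact le_of_mul_le_mul_left this hD0
  have h5 : ∀ t ∈ Set.Ioo 0 D', h t ≤ d.perim →
      5 * h t ^ (1 / (N - 1)) ≤ h x0 ^ (1 / (N - 1)) := by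
    intro t ht htP
    have hht : 0 < h t := hh.1.2.1 t ht
    have e1 : 5 ^ (N - 1) * h t ≤ h x0 := le_trans (by gcongr) h5'
    have := Real.rpow_le_rpow (by positivity) e1 (by positivity : 0 ≤ 1 / (N - 1))
    rwa [Real.mul_rpow (by positivity) hht.le, ← Real.rpow_mul (by norm_num),
      mul_one_div_cancel hN1.ne', Real.rpow_one] at this
  have hW : (5 * D' / 4 * d.perim / N) ^ (N / (N - 1)) ≤ T * w := by
    have e1 : 5 * D' / 4 * d.perim / N ≤ 3 / 2 * w ^ (1 - 1 / N) := by
      rw [div_le_iff₀ (by linarith)]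
      linarith
    have e2 := Real.rpow_le_rpow (by positivity) e1 hppos.le
    rwa [Real.mul_rpow (by norm_num) (by positivity), ← Real.rpow_mul hwpos.le, mul_comm (1 - 1 / N),
      hpq, Real.rpow_one] at e2
  have hcore := core hN hh d hx0 h5 hmw hW hw2
  have htot := total_bound hN hD0 hh d (fun i hi => (hcore i hi).2)
  rw [← hm, ← hp] at htot
  have hmP : m ^ (1 - 1 / N) ≤ 5 * D' / 4 * d.perim / N := by
    have e := Real.rpow_le_rpow hm0.le htot hqpos.le
    rwa [← Real.rpow_mul (by positivity), hpq, Real.rpow_one] at e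
  have hPpos : 0 < d.perim := by
    rcases hP0.eq_or_lt with h0 | h0
    · rw [← h0, mul_zero, zero_div] at hmP; linarith
    · exact h0
  have hD2 : D ≤ 3 / 2 * D' := by
    rw [le_div_iff₀ (by linarith)] at hmP
    have : D * d.perim ≤ (3 / 2 * D') * d.perim := by linarith
    exact le_of_mul_le_mul_right this hPpos
  -- all intervals are on the left
  have hleft : ∀ i, d.a i < d.b i → d.b i < x0 := by
    intro i hi
    rcases (hcore i hi).1 with h1 | h1
    · exact h1
    exfalso
    have hal := (a_le_perimTerm hh.1 d hi (by linarith [hx0.1])).trans (perimTerm_le hh.1 d i)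
    have haD : d.a i < D' := hi.trans_le (d.le_top i)
    have h2 := near_right hh.1 hx0.1 h1 haD (h5 _ ⟨by linarith [hx0.1], haD⟩ hal)
    have h3 : L < d.a i := by linarith
    have h4 : volume (E ∩ Set.Ioo (d.a i) (d.b i)) = 0 := by
      have : E ∩ Set.Ioo (d.a i) (d.b i) = ∅ := by
        ext x
        simp only [Set.mem_inter_iff, Set.mem_empty_iff_false, iff_false]
        rintro ⟨hx, hx'⟩
        linarith [(hEL hx).2, hx'.1]
      rw [this]; simp
    rw [measure_congr (d.aeEq.inter (ae_eq_refl (Set.Ioo (d.a i) (d.b i)))),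
      Set.inter_eq_right.2 (Set.subset_iUnion (fun i => Set.Ioo (d.a i) (d.b i)) i),
      Real.volume_Ioo, ENNReal.ofReal_eq_zero] at h4
    linarith
  have hmonoi : ∀ i, d.a i < d.b i → StrictMonoOn h (Set.Icc 0 (d.b i)) := by
    intro i hi
    have hbD : d.b i < D' := (hleft i hi).trans hx0.2
    have hb0 : 0 < d.b i := (d.nonneg i).trans_lt hi
    have hbl := (b_le_perimTerm hh.1 d hi hbD.ne).trans (perimTerm_le hh.1 d i)
    refine strictMono_left hN hh.1 hb0 (hleft i hi) hx0.2 ?_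
    have h6 := h5 _ ⟨hb0, hbD⟩ hbl
    have hhb := hh.1.2.1 _ ⟨hb0, hbD⟩
    have h7 : 0 < h (d.b i) ^ (1 / (N - 1)) := by positivity
    exact (Real.rpow_lt_rpow_iff hhb.le hhx0.le (by positivity : 0 < 1 / (N - 1))).1 (by linarith)
  -- a nondegenerate interval
  have hex : ∃ i, d.a i < d.b i := by
    by_contra hc
    push Not at hc
    have hs := mass_hasSum hh d
    have h0 : (fun i => ∫ x in Set.Ioo (d.a i) (d.b i), h x) = fun _ => 0 := by
      funext i
      rw [Set.Ioo_eq_empty (not_lt.2 (hc i))]; simp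
    rw [h0] at hs
    have := hs.unique hasSum_zero
    linarith
  obtain ⟨i1, hi1⟩ := hex
  have hb1 : 0 < d.b i1 := (d.nonneg i1).trans_lt hi1
  have hhb1 : 0 < h (d.b i1) := hh.1.2.1 _ ⟨hb1, (hleft i1 hi1).trans hx0.2⟩
  have hfin : {i | d.a i < d.b i ∧ d.b i1 ≤ d.b i}.Finite := by
    have hs : Summable (perimTerm d) := d.summablePerim
    have h1 := hs.tendsto_cofinite_zero.eventually (gt_mem_nhds hhb1)
    refine Set.Finite.subset (Filter.eventually_cofinite.1 h1) ?_
    rintro i ⟨hi, hbi⟩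
    have hbD : d.b i < D' := (hleft i hi).trans hx0.2
    have h2 := b_le_perimTerm hh.1 d hi hbD.ne
    have h3 : h (d.b i1) ≤ h (d.b i) :=
      (hmonoi i hi).monotoneOn ⟨hb1.le, hbi⟩ ⟨hb1.le.trans hbi, le_rfl⟩ hbi
    exact not_lt.2 (h3.trans h2)
  obtain ⟨k, hk, hkmax⟩ := hfin.exists_maximalFor d.b _ ⟨i1, hi1, le_rfl⟩
  have hmax : ∀ i, d.a i < d.b i → d.b i ≤ d.b k := by
    intro i hi
    by_contra hc
    push Not at hc
    exact hc.not_ge (hkmax ⟨hi, hk.2.trans hc.le⟩ hc.le)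
  obtain ⟨hess, hst⟩ := structure_aux d k hk.1 hmax
  rw [hess]
  exact ⟨hst, hmonoi k hk.1⟩
end
end

section
/- Fix a real number N > 1 and L > 0. For every ε > 0 there exist w̄ > 0 and δ̄ > 0 such that for all D ≥ 3L, all D' ∈ (0, D], every probability CD(0,N) density h on [0,D'], and every interval set E ⊆ [0, L] with 0 < m_h(E) ≤ w̄ and Res_h^D(E) ≤ δ̄, one has |h̃_E(t) − N·t^{N−1}| ≤ ε for Lebesgue-almost every t ∈ (0,1). -/
open MeasureTheory
open scoped Classical

noncomputable section

/-- The normalized rescaled density `h̃_E(t) = 1_E(b(E) t) · (b(E)/m_h(E)) · h(b(E) t)`. -/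
def tildeDensity (h : ℝ → ℝ) (E : Set ℝ) (t : ℝ) : ℝ :=
  Set.indicator E (fun y => (essSupSet E / (∫ x in E, h x)) * h y) (essSupSet E * t)

theorem aux_supergrad {f : ℝ → ℝ} {l b : ℝ} (hf : ConcaveOn ℝ (Set.Icc 0 l) f) (hb : b ∈ Set.Ioo 0 l) :
    ∃ s : ℝ, ∀ y ∈ Set.Icc 0 l, f y ≤ f b + s * (y - b) := by
  have hc : ConvexOn ℝ (Set.Icc 0 l) (-f) := hf.neg
  have hbi : b ∈ interior (Set.Icc 0 l) := by rw [interior_Icc]; exact hb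
  refine ⟨- derivWithin (-f) (Set.Ioi b) b, fun y hy => ?_⟩
  rcases lt_trichotomy y b with h | h | h
  · have h1 := hc.slope_le_leftDeriv_of_mem_interior hy hbi h
    have h2 := h1.trans (hc.leftDeriv_le_rightDeriv_of_mem_interior hbi)
    rw [slope_def_field, div_le_iff₀ (by linarith)] at h2
    simp only [Pi.neg_apply] at h2
    nlinarith
  · subst h; simp
  · have h2 := hc.rightDeriv_le_slope_of_mem_interior hbi hy h
    rw [slope_def_field, le_div_iff₀ (by linarith)] at h2
    simp only [Pi.neg_apply] at h2
    nlinarith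

theorem aux_int {N B r v : ℝ} (hN : 1 < N) (hB : 0 < B) (u : ℝ) :
    ∫ y in u..v, (y / B + r) ^ (N - 1) = B / N * ((v / B + r) ^ N - (u / B + r) ^ N) := by
  rw [intervalIntegral.integral_comp_div_add (fun x => x ^ (N - 1)) hB.ne', integral_rpow (by left; linarith)]
  have : N - 1 + 1 = N := by ring
  rw [this, smul_eq_mul]
  ring

/-- interval integral comparison with the model. -/
theorem aux_int_le {h g : ℝ → ℝ} {u v : ℝ} (huv : u ≤ v) (hi : IntegrableOn h (Set.Icc u v))
    (hg : Continuous g) (hle : ∀ y ∈ Set.Icc u v, h y ≤ g y) :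
    ∫ y in Set.Icc u v, h y ≤ ∫ y in u..v, g y := by
  rw [intervalIntegral.integral_of_le huv, ← integral_Icc_eq_integral_Ioc]
  exact setIntegral_mono_on hi (hg.continuousOn.integrableOn_Icc) measurableSet_Icc hle

theorem aux_le_int {h g : ℝ → ℝ} {u v : ℝ} (huv : u ≤ v) (hi : IntegrableOn h (Set.Icc u v))
    (hg : Continuous g) (hle : ∀ y ∈ Set.Icc u v, g y ≤ h y) :
    ∫ y in u..v, g y ≤ ∫ y in Set.Icc u v, h y := by
  rw [intervalIntegral.integral_of_le huv, ← integral_Icc_eq_integral_Ioc]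
  exact setIntegral_mono_on (hg.continuousOn.integrableOn_Icc) hi measurableSet_Icc hle

theorem aux_cont {N B r : ℝ} (hN : 1 < N) : Continuous (fun y : ℝ => (y / B + r) ^ (N - 1)) := by
  refine Continuous.rpow_const (by fun_prop) (fun x => Or.inr (by linarith))

/-- Core estimate at a point where the slope is nonnegative. -/
theorem aux_core {N l η b s : ℝ} {f h : ℝ → ℝ} (hN : 1 < N) (hη : 0 < η)
    (hb : b ∈ Set.Ioo 0 l)
    (hf0 : ∀ y ∈ Set.Icc 0 l, 0 ≤ f y) (hfb : 0 < f b)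
    (hh : ∀ y ∈ Set.Icc 0 l, h y = f y ^ (N - 1))
    (hi : IntegrableOn h (Set.Icc 0 l)) (hs0 : 0 ≤ s)
    (hs : ∀ y ∈ Set.Icc 0 l, f y ≤ f b + s * (y - b)) :
    (∫ y in Set.Icc 0 l, h y) ≤ (1 + 1 / η) ^ (N - 1) * (l * h b) ∨
    ∃ ρ : ℝ, 0 ≤ ρ ∧ ρ < 1 ∧
      N * ((∫ y in Set.Icc 0 l, h y) ^ (1 / N) * (∫ y in Set.Icc 0 b, h y) ^ (1 - 1 / N))
        ≤ (1 + η) * (l * h b) * (1 - ρ ^ N) ^ (1 - 1 / N) ∧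
      (∀ y ∈ Set.Icc 0 b, h y ≤ h b * (y / b + ρ * (1 - y / b)) ^ (N - 1)) ∧
      N * (∫ y in Set.Icc 0 b, h y) * (1 - ρ) ≤ b * h b := by
  obtain ⟨hb0, hbl⟩ := hb
  have hl : 0 < l := hb0.trans hbl
  have hbm : b ∈ Set.Icc 0 l := ⟨hb0.le, hbl.le⟩
  have hp : 0 < N - 1 := by linarith
  have hhb : 0 < h b := by rw [hh b hbm]; exact Real.rpow_pos_of_pos hfb _
  -- crude bound
  have crude : ∀ c : ℝ, 0 ≤ c → (∀ y ∈ Set.Icc 0 l, f y ≤ f b * c) →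
      (∫ y in Set.Icc 0 l, h y) ≤ c ^ (N - 1) * (l * h b) := by
    intro c hc hle
    have := aux_int_le hl.le hi (g := fun _ => c ^ (N - 1) * h b) continuous_const (by
      intro y hy
      rw [hh y hy, hh b hbm, mul_comm, ← Real.mul_rpow hfb.le hc]
      exact Real.rpow_le_rpow (hf0 y hy) (hle y hy) hp.le)
    rw [intervalIntegral.integral_const] at this
    simp only [smul_eq_mul, sub_zero] at this
    linarith
  have hη1 : 0 < 1 / η := by positivity
  rcases hs0.eq_or_lt with h0 | hspos
  · left
    apply crude _ (by linarith)
    intro y hy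
    have := hs y hy
    rw [← h0] at this
    nlinarith
  set B := f b / s with hB
  have hBpos : 0 < B := by positivity
  have hsB : s = f b / B := by rw [hB]; field_simp
  have hbB : b ≤ B := by
    have h1 := hs 0 ⟨le_rfl, hl.le⟩
    have h2 := hf0 0 ⟨le_rfl, hl.le⟩
    rw [hB, le_div_iff₀ hspos]; linarith
  set ρ := 1 - b / B with hρ
  have hρ0 : 0 ≤ ρ := by
    have : b / B ≤ 1 := by rw [div_le_one hBpos]; exact hbB
    rw [hρ]; linarith
  have hρ1 : ρ < 1 := by
    have : 0 < b / B := by positivity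
    rw [hρ]; linarith
  have hs' : ∀ y ∈ Set.Icc 0 l, f y ≤ f b * (y / B + ρ) := by
    intro y hy
    have := hs y hy
    rw [hsB] at this
    calc f y ≤ _ := this
      _ = _ := by rw [hρ]; field_simp; ring
  rcases le_or_gt (η * l) B with hBl | hBl
  · left
    apply crude _ (by linarith)
    intro y hy
    refine (hs' y hy).trans (mul_le_mul_of_nonneg_left ?_ hfb.le)
    have : y / B ≤ 1 / η := by
      rw [div_le_div_iff₀ hBpos hη]; nlinarith [hy.2]
    linarith
  right
  have hs2 : ∀ y ∈ Set.Icc 0 l, h y ≤ h b * (y / B + ρ) ^ (N - 1) := by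
    intro y hy
    have : 0 ≤ y / B := div_nonneg hy.1 hBpos.le
    rw [hh y hy, hh b hbm, ← Real.mul_rpow hfb.le (by linarith)]
    exact Real.rpow_le_rpow (hf0 y hy) (hs' y hy) hp.le
  have hib : IntegrableOn h (Set.Icc 0 b) := hi.mono_set (Set.Icc_subset_Icc_right hbl.le)
  have hK0 : 0 ≤ ∫ y in Set.Icc 0 l, h y :=
    setIntegral_nonneg measurableSet_Icc (fun y hy => by rw [hh y hy]; exact Real.rpow_nonneg (hf0 y hy) _)
  have hM0 : 0 ≤ ∫ y in Set.Icc 0 b, h y :=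
    setIntegral_nonneg measurableSet_Icc (fun y hy => by
      have hy' : y ∈ Set.Icc 0 l := ⟨hy.1, hy.2.trans hbl.le⟩
      rw [hh y hy']; exact Real.rpow_nonneg (hf0 y hy') _)
  have hM := aux_int_le hb0.le hib (g := fun y => h b * (y / B + ρ) ^ (N - 1))
    (continuous_const.mul (aux_cont hN)) (fun y hy => hs2 y ⟨hy.1, hy.2.trans hbl.le⟩)
  have hK := aux_int_le hl.le hi (g := fun y => h b * (y / B + ρ) ^ (N - 1))
    (continuous_const.mul (aux_cont hN)) hs2
  rw [intervalIntegral.integral_const_mul, aux_int hN hBpos] at hM hK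
  have e1 : b / B + ρ = 1 := by rw [hρ]; ring
  rw [e1, Real.one_rpow, zero_div, zero_add] at hM
  rw [zero_div, zero_add] at hK
  set K := ∫ y in Set.Icc 0 l, h y
  set M := ∫ y in Set.Icc 0 b, h y
  have hN0 : 0 < N := by linarith
  set q := l * (1 + η) / B with hq
  have hq0 : 0 < q := by positivity
  have hρN : 0 ≤ ρ ^ N := Real.rpow_nonneg hρ0 _
  have hρN1 : ρ ^ N ≤ 1 := Real.rpow_le_one hρ0 hρ1.le hN0.le
  have hqle : l / B + ρ ≤ q := by
    have : q = l / B + η * l / B := by rw [hq]; field_simp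
    rw [this]
    have : 1 ≤ η * l / B := by rw [one_le_div hBpos]; exact hBl.le
    linarith
  have hA0 : 0 ≤ h b * (B / N) := by positivity
  have hKq : K ≤ h b * (B / N) * q ^ N := by
    have : (l / B + ρ) ^ N ≤ q ^ N :=
      Real.rpow_le_rpow (by have : 0 < l / B := by positivity
                            linarith) hqle hN0.le
    calc K ≤ h b * (B / N) * ((l / B + ρ) ^ N - ρ ^ N) := by linarith
      _ ≤ _ := mul_le_mul_of_nonneg_left (by linarith) hA0
  have hMq : M ≤ h b * (B / N) * (1 - ρ ^ N) := by linarith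
  have hα : 0 ≤ 1 - 1 / N := by
    have : 1 / N ≤ 1 := by rw [div_le_one hN0]; exact hN.le
    linarith
  refine ⟨ρ, hρ0, hρ1, ?_, ?_, ?_⟩
  · have k1 : K ^ (1 / N) ≤ (h b * (B / N)) ^ (1 / N) * q := by
      have := Real.rpow_le_rpow hK0 hKq (by positivity : 0 ≤ 1 / N)
      rw [Real.mul_rpow hA0 (by positivity), ← Real.rpow_mul hq0.le, mul_one_div_cancel hN0.ne',
        Real.rpow_one] at this
      exact this
    have k2 : M ^ (1 - 1 / N) ≤ (h b * (B / N)) ^ (1 - 1 / N) * (1 - ρ ^ N) ^ (1 - 1 / N) := by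
      have := Real.rpow_le_rpow hM0 hMq hα
      rwa [Real.mul_rpow hA0 (by linarith)] at this
    have k3 : (h b * (B / N)) ^ (1 / N) * (h b * (B / N)) ^ (1 - 1 / N) = h b * (B / N) := by
      rw [← Real.rpow_add (by positivity)]; simp
    calc N * (K ^ (1 / N) * M ^ (1 - 1 / N))
        ≤ N * (((h b * (B / N)) ^ (1 / N) * q) *
            ((h b * (B / N)) ^ (1 - 1 / N) * (1 - ρ ^ N) ^ (1 - 1 / N))) := by
          gcongr
      _ = N * (((h b * (B / N)) ^ (1 / N) * (h b * (B / N)) ^ (1 - 1 / N)) * q *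
            (1 - ρ ^ N) ^ (1 - 1 / N)) := by ring
      _ = _ := by rw [k3, hq]; field_simp
  · intro y hy
    have := hs2 y ⟨hy.1, hy.2.trans hbl.le⟩
    have e : y / B + ρ = y / b + ρ * (1 - y / b) := by
      rw [hρ]; field_simp; ring
    rwa [e] at this
  · have : (1 - ρ) = b / B := by rw [hρ]; ring
    rw [this]
    calc N * M * (b / B) ≤ N * (h b * (B / N)) * (b / B) := by
          gcongr
          nlinarith
      _ = b * h b := by field_simp

theorem aux_Icc {h : ℝ → ℝ} {u v : ℝ} (huv : u ≤ v) :
    ∫ y in Set.Icc u v, h y = ∫ y in u..v, h y := by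
  rw [intervalIntegral.integral_of_le huv, ← integral_Icc_eq_integral_Ioc]

theorem aux_core_left {N l η b s : ℝ} {f h : ℝ → ℝ} (hN : 1 < N) (hη : 0 < η)
    (hb : b ∈ Set.Ioo 0 l)
    (hf0 : ∀ y ∈ Set.Icc 0 l, 0 ≤ f y) (hfb : 0 < f b)
    (hh : ∀ y ∈ Set.Icc 0 l, h y = f y ^ (N - 1))
    (hi : IntegrableOn h (Set.Icc 0 l)) (hs0 : 0 ≤ s)
    (hs : ∀ y ∈ Set.Icc 0 l, f y ≤ f b + s * (y - b)) :
    (∫ y in Set.Icc 0 l, h y) ≤ (1 + 1 / η) ^ (N - 1) * (l * h b) ∨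
      N * ((∫ y in Set.Icc 0 l, h y) ^ (1 / N) * (∫ y in Set.Icc 0 b, h y) ^ (1 - 1 / N))
        ≤ (1 + η) * (l * h b) := by
  rcases aux_core hN hη hb hf0 hfb hh hi hs0 hs with h1 | ⟨ρ, h0, h1, h2, -, -⟩
  · exact Or.inl h1
  right
  refine h2.trans ?_
  have hN0 : 0 < N := by linarith
  have hρN : 0 ≤ ρ ^ N := Real.rpow_nonneg h0 _
  have hρN1 : ρ ^ N ≤ 1 := Real.rpow_le_one h0 h1.le hN0.le
  have hα : 0 ≤ 1 - 1 / N := by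
    have : 1 / N ≤ 1 := by rw [div_le_one hN0]; exact hN.le
    linarith
  have : (1 - ρ ^ N) ^ (1 - 1 / N) ≤ 1 := Real.rpow_le_one (by linarith) (by linarith) hα
  have hhb : 0 ≤ h b := by rw [hh b ⟨hb.1.le, hb.2.le⟩]; exact Real.rpow_nonneg hfb.le _
  have hl : 0 < l := hb.1.trans hb.2
  exact mul_le_of_le_one_right (by positivity) this

theorem aux_core_right {N l η a s : ℝ} {f h : ℝ → ℝ} (hN : 1 < N) (hη : 0 < η)
    (ha : a ∈ Set.Ioo 0 l)
    (hf0 : ∀ y ∈ Set.Icc 0 l, 0 ≤ f y) (hfa : 0 < f a)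
    (hh : ∀ y ∈ Set.Icc 0 l, h y = f y ^ (N - 1))
    (hi : IntegrableOn h (Set.Icc 0 l)) (hs0 : s ≤ 0)
    (hs : ∀ y ∈ Set.Icc 0 l, f y ≤ f a + s * (y - a)) :
    (∫ y in Set.Icc 0 l, h y) ≤ (1 + 1 / η) ^ (N - 1) * (l * h a) ∨
      N * ((∫ y in Set.Icc 0 l, h y) ^ (1 / N) * (∫ y in Set.Icc a l, h y) ^ (1 - 1 / N))
        ≤ (1 + η) * (l * h a) := by
  have hl : 0 < l := ha.1.trans ha.2
  have hm : ∀ y ∈ Set.Icc 0 l, l - y ∈ Set.Icc 0 l := fun y hy =>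
    ⟨by linarith [hy.2], by linarith [hy.1]⟩
  have key := aux_core_left (N := N) (l := l) (η := η) (b := l - a) (s := -s)
    (f := fun y => f (l - y)) (h := fun y => h (l - y)) hN hη
    ⟨by linarith [ha.2], by linarith [ha.1]⟩ (fun y hy => hf0 _ (hm y hy))
    (by simpa using hfa) (fun y hy => hh _ (hm y hy))
    (by
      have := (intervalIntegrable_iff_integrableOn_Icc_of_le hl.le).2 hi
      have := this.comp_sub_left l
      simp only [sub_zero, sub_self] at this
      exact (intervalIntegrable_iff_integrableOn_Icc_of_le hl.le).1 this.symm)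
    (by linarith)
    (fun y hy => by
      have := hs _ (hm y hy)
      simp only [sub_sub_cancel]
      linarith)
  rw [aux_Icc hl.le, aux_Icc (by linarith [ha.2] : (0:ℝ) ≤ l - a),
    intervalIntegral.integral_comp_sub_left, intervalIntegral.integral_comp_sub_left] at key
  simp only [sub_zero, sub_self, sub_sub_cancel] at key
  rw [aux_Icc hl.le, aux_Icc ha.2.le]
  exact key

theorem aux_interval {N l η a b : ℝ} {f h : ℝ → ℝ} (hN : 1 < N) (hη : 0 < η)
    (ha : 0 ≤ a) (hab : a < b) (hbl : b ≤ l)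
    (hc : ConcaveOn ℝ (Set.Icc 0 l) f)
    (hf0 : ∀ y ∈ Set.Icc 0 l, 0 ≤ f y) (hf1 : ∀ y ∈ Set.Ioo 0 l, 0 < f y)
    (hh : ∀ y ∈ Set.Icc 0 l, h y = f y ^ (N - 1))
    (hi : IntegrableOn h (Set.Icc 0 l)) (T : ℝ) (hT : T =
      (if a ≠ 0 then h a else 0) + (if b ≠ l then h b else 0)) :
    (∫ y in Set.Icc 0 l, h y) ≤ (1 + 1 / η) ^ (N - 1) * (l * T) ∨
    (∫ y in Set.Icc 0 l, h y) - (∫ y in Set.Ioo a b, h y) ≤ l * T ∨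
      N * ((∫ y in Set.Icc 0 l, h y) ^ (1 / N) * (∫ y in Set.Ioo a b, h y) ^ (1 - 1 / N))
        ≤ (1 + η) * (l * T) := by
  have hl : 0 < l := by linarith
  have hN0 : 0 < N := by linarith
  have hp : 0 < N - 1 := by linarith
  have hα : 0 ≤ 1 - 1 / N := by
    have : 1 / N ≤ 1 := by rw [div_le_one hN0]; exact hN.le
    linarith
  have hh0 : ∀ y ∈ Set.Icc 0 l, 0 ≤ h y := fun y hy => by
    rw [hh y hy]; exact Real.rpow_nonneg (hf0 y hy) _
  have ham : a ∈ Set.Icc 0 l := ⟨ha, by linarith⟩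
  have hbm : b ∈ Set.Icc 0 l := ⟨by linarith, by linarith⟩
  have hC : 0 ≤ (1 + 1 / η) ^ (N - 1) := by positivity
  have hK0 : 0 ≤ ∫ y in Set.Icc 0 l, h y := setIntegral_nonneg measurableSet_Icc hh0
  have hμ0 : 0 ≤ ∫ y in Set.Ioo a b, h y := setIntegral_nonneg measurableSet_Ioo
    (fun y hy => hh0 y ⟨by linarith [hy.1], by linarith [hy.2]⟩)
  have hta : 0 ≤ (if a ≠ 0 then h a else 0) := by
    split_ifs
    · exact hh0 a ham
    · exact le_rfl
  have htb : 0 ≤ (if b ≠ l then h b else 0) := by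
    split_ifs
    · exact hh0 b hbm
    · exact le_rfl
  have mono : ∀ S : Set ℝ, MeasurableSet S → Set.Ioo a b ⊆ S → S ⊆ Set.Icc 0 l →
      (∫ y in Set.Ioo a b, h y) ≤ ∫ y in S, h y := fun S hS h1 h2 =>
    setIntegral_mono_set (hi.mono_set h2)
      ((ae_restrict_iff' hS).2 (Filter.Eventually.of_forall fun y hy => hh0 y (h2 hy)))
      (Filter.Eventually.of_forall h1)
  -- the contribution on the right
  have Rb : ((∫ y in Set.Icc 0 l, h y) ≤ (1 + 1 / η) ^ (N - 1) * (l * T) ∨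
      N * ((∫ y in Set.Icc 0 l, h y) ^ (1 / N) * (∫ y in Set.Ioo a b, h y) ^ (1 - 1 / N))
        ≤ (1 + η) * (l * T)) ∨
      (∫ y in Set.Icc b l, h y) ≤ l * (if b ≠ l then h b else 0) := by
    by_cases hbl' : b = l
    · right; simp [hbl']
    have hb : b ∈ Set.Ioo 0 l := ⟨by linarith, lt_of_le_of_ne hbl hbl'⟩
    obtain ⟨s, hs⟩ := aux_supergrad hc hb
    rw [if_pos hbl'] at hT htb ⊢
    have hle : h b ≤ T := by linarith
    rcases le_total 0 s with hs0 | hs0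
    · left
      rcases aux_core_left hN hη hb hf0 (hf1 b hb) hh hi hs0 hs with h1 | h1
      · left
        exact h1.trans (by gcongr)
      · right
        refine le_trans ?_ (h1.trans (by gcongr))
        exact mul_le_mul_of_nonneg_left (mul_le_mul_of_nonneg_left (Real.rpow_le_rpow hμ0
          (mono _ measurableSet_Icc (fun y hy => ⟨by linarith [hy.1], hy.2.le⟩)
          (Set.Icc_subset_Icc_right hbl)) hα) (by positivity)) hN0.le
    · right
      have := aux_int_le hbl (hi.mono_set (Set.Icc_subset_Icc_left hb.1.le))
        (g := fun _ => h b) continuous_const (fun y hy => by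
          have hy' : y ∈ Set.Icc 0 l := ⟨by linarith [hy.1, hb.1], hy.2⟩
          rw [hh y hy', hh b hbm]
          refine Real.rpow_le_rpow (hf0 y hy') ?_ hp.le
          nlinarith [hs y hy', hy.1])
      rw [intervalIntegral.integral_const, smul_eq_mul] at this
      nlinarith [hb.1]
  have Ra : ((∫ y in Set.Icc 0 l, h y) ≤ (1 + 1 / η) ^ (N - 1) * (l * T) ∨
      N * ((∫ y in Set.Icc 0 l, h y) ^ (1 / N) * (∫ y in Set.Ioo a b, h y) ^ (1 - 1 / N))
        ≤ (1 + η) * (l * T)) ∨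
      (∫ y in Set.Icc 0 a, h y) ≤ l * (if a ≠ 0 then h a else 0) := by
    by_cases ha' : a = 0
    · right; simp [ha']
    have hb : a ∈ Set.Ioo 0 l := ⟨lt_of_le_of_ne ha (Ne.symm ha'), by linarith⟩
    obtain ⟨s, hs⟩ := aux_supergrad hc hb
    rw [if_pos ha'] at hT hta ⊢
    have hle : h a ≤ T := by linarith
    rcases le_total s 0 with hs0 | hs0
    · left
      rcases aux_core_right hN hη hb hf0 (hf1 a hb) hh hi hs0 hs with h1 | h1
      · left
        exact h1.trans (by gcongr)
      · right
        refine le_trans ?_ (h1.trans (by gcongr))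
        exact mul_le_mul_of_nonneg_left (mul_le_mul_of_nonneg_left (Real.rpow_le_rpow hμ0
          (mono _ measurableSet_Icc (fun y hy => ⟨hy.1.le, by linarith [hy.2]⟩)
          (Set.Icc_subset_Icc_left ha)) hα) (by positivity)) hN0.le
    · right
      have := aux_int_le ha (hi.mono_set (Set.Icc_subset_Icc_right hb.2.le))
        (g := fun _ => h a) continuous_const (fun y hy => by
          have hy' : y ∈ Set.Icc 0 l := ⟨hy.1, by linarith [hy.2, hb.2]⟩
          rw [hh y hy', hh a ham]
          refine Real.rpow_le_rpow (hf0 y hy') ?_ hp.le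
          nlinarith [hs y hy', hy.2])
      rw [intervalIntegral.integral_const, smul_eq_mul] at this
      nlinarith [hb.2]
  rcases Rb with (h1 | h1) | hRb
  · exact Or.inl h1
  · exact Or.inr (Or.inr h1)
  rcases Ra with (h1 | h1) | hRa
  · exact Or.inl h1
  · exact Or.inr (Or.inr h1)
  right; left
  have ii := (intervalIntegrable_iff_integrableOn_Icc_of_le hl.le).2 hi
  have i1 : IntervalIntegrable h volume 0 a :=
    (intervalIntegrable_iff_integrableOn_Icc_of_le ha).2 (hi.mono_set (Set.Icc_subset_Icc_right ham.2))
  have i2 : IntervalIntegrable h volume a b :=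
    (intervalIntegrable_iff_integrableOn_Icc_of_le hab.le).2 (hi.mono_set (Set.Icc_subset_Icc ha hbl))
  have i3 : IntervalIntegrable h volume b l :=
    (intervalIntegrable_iff_integrableOn_Icc_of_le hbl).2 (hi.mono_set (Set.Icc_subset_Icc_left hbm.1))
  have e1 := intervalIntegral.integral_add_adjacent_intervals i1 i2
  have e2 := intervalIntegral.integral_add_adjacent_intervals (i1.trans i2) i3
  rw [← integral_Icc_eq_integral_Ioo, aux_Icc hl.le, aux_Icc hab.le]
  rw [aux_Icc hbl] at hRb
  rw [aux_Icc ha] at hRa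
  rw [hT]
  linarith

/-- the `i`-th contribution to the perimeter -/
def auxTerm {D' : ℝ} {h : ℝ → ℝ} {E : Set ℝ} (d : IntervalDecomp D' h E) (i : ℕ) : ℝ :=
  (if d.a i < d.b i ∧ d.a i ≠ 0 then h (d.a i) else 0) +
         (if d.a i < d.b i ∧ d.b i ≠ D' then h (d.b i) else 0)

theorem aux_b_le {D' L : ℝ} {h : ℝ → ℝ} {E : Set ℝ} (d : IntervalDecomp D' h E)
    (hE : E ⊆ Set.Icc 0 L) (i : ℕ) (hi : d.a i < d.b i) : d.b i ≤ L := by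
  by_contra hcon
  push Not at hcon
  have h0 : volume ((⋃ i, Set.Ioo (d.a i) (d.b i)) \ E) = 0 := ae_le_set.1 d.aeEq.symm.le
  have h1 : Set.Ioo (max (d.a i) L) (d.b i) ⊆ (⋃ i, Set.Ioo (d.a i) (d.b i)) \ E := by
    intro y hy
    refine ⟨Set.mem_iUnion.2 ⟨i, (le_max_left _ _).trans_lt hy.1, hy.2⟩, fun hyE => ?_⟩
    have := (le_max_right (d.a i) L).trans_lt hy.1
    linarith [(hE hyE).2]
  have h2 := measure_mono_null h1 h0
  rw [Real.volume_Ioo, ENNReal.ofReal_eq_zero] at h2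
  have : max (d.a i) L < d.b i := max_lt hi hcon
  linarith

theorem aux_term_nonneg {D' : ℝ} {h : ℝ → ℝ} {E : Set ℝ} (d : IntervalDecomp D' h E)
    (h0 : ∀ x ∈ Set.Icc (0:ℝ) D', 0 ≤ h x) (i : ℕ) : 0 ≤ auxTerm d i := by
  have ha : 0 ≤ h (d.a i) := h0 _ ⟨d.nonneg i, (d.le i).trans (d.le_top i)⟩
  have hb : 0 ≤ h (d.b i) := h0 _ ⟨(d.nonneg i).trans (d.le i), d.le_top i⟩
  unfold auxTerm
  split_ifs <;> linarith

theorem aux_term_le {D' : ℝ} {h : ℝ → ℝ} {E : Set ℝ} (d : IntervalDecomp D' h E)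
    (h0 : ∀ x ∈ Set.Icc (0:ℝ) D', 0 ≤ h x) (i : ℕ) : auxTerm d i ≤ d.perim :=
  d.summablePerim.le_tsum i (fun j _ => aux_term_nonneg d h0 j)

theorem aux_hasSum {D' : ℝ} {h : ℝ → ℝ} {E : Set ℝ} (d : IntervalDecomp D' h E)
    (hi : IntegrableOn h (Set.Icc 0 D')) :
    HasSum (fun i => ∫ x in Set.Ioo (d.a i) (d.b i), h x) (∫ x in E, h x) := by
  rw [setIntegral_congr_set d.aeEq]
  refine hasSum_integral_iUnion (fun i => measurableSet_Ioo) ?_ (hi.mono_set ?_)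
  · intro i j hij
    rw [Function.onFun, Set.disjoint_left]
    intro y hy hy'
    rcases d.sep i j hij with h1 | h1
    · linarith [hy.2, hy'.1]
    · linarith [hy.1, hy'.2]
  · refine Set.iUnion_subset fun i y hy => ⟨by linarith [d.nonneg i, hy.1], by linarith [d.le_top i, hy.2]⟩

theorem aux_caseA {N L D D' η : ℝ} {f h : ℝ → ℝ} {E : Set ℝ} (hN : 1 < N) (hL : 0 < L)
    (hη : 0 < η) (hD : 3 * L ≤ D) (hD' : D' ∈ Set.Ioc 0 D) (hE : E ⊆ Set.Icc 0 L)
    (d : IntervalDecomp D' h E)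
    (hc : ConcaveOn ℝ (Set.Icc 0 D') f)
    (hf0 : ∀ y ∈ Set.Icc 0 D', 0 ≤ f y) (hf1 : ∀ y ∈ Set.Ioo 0 D', 0 < f y)
    (hh : ∀ y ∈ Set.Icc 0 D', h y = f y ^ (N - 1))
    (hi : IntegrableOn h (Set.Icc 0 D'))
    (hm : 0 < ∫ x in E, h x)
    (hCQ : (1 + 1 / η) ^ (N - 1) * (D * d.perim) < 1 / 2)
    (hmQ : (∫ x in E, h x) + D * d.perim < 1 / 2)
    (hQ : (1 + η) * (D * d.perim) < 3 / 2 * N * (∫ x in E, h x) ^ (1 - 1 / N))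
    (hκ : 1 / 2 ≤ ∫ x in Set.Icc 0 (min L D'), h x) : False := by
  have hN0 : 0 < N := by linarith
  have hα : 0 ≤ 1 - 1 / N := by
    have : 1 / N ≤ 1 := by rw [div_le_one hN0]; exact hN.le
    linarith
  have hh0 : ∀ y ∈ Set.Icc 0 D', 0 ≤ h y := fun y hy => by
    rw [hh y hy]; exact Real.rpow_nonneg (hf0 y hy) _
  set l := min L D' with hl
  have hlpos : 0 < l := lt_min hL hD'.1
  have hlL : l ≤ L := min_le_left _ _
  have hlD' : l ≤ D' := min_le_right _ _
  have hsub : Set.Icc 0 l ⊆ Set.Icc 0 D' := Set.Icc_subset_Icc_right hlD'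
  set κ := ∫ x in Set.Icc 0 l, h x
  have hsum := aux_hasSum d hi
  set m := ∫ x in E, h x
  set μ : ℕ → ℝ := fun i => ∫ x in Set.Ioo (d.a i) (d.b i), h x with hμ
  have hμ0 : ∀ i, 0 ≤ μ i := fun i => setIntegral_nonneg measurableSet_Ioo
    (fun y hy => hh0 y ⟨by linarith [hy.1, d.nonneg i], by linarith [hy.2, d.le_top i]⟩)
  have hμm : ∀ i, μ i ≤ m := fun i => le_hasSum hsum i (fun j _ => hμ0 j)
  have hκ2 : 1 / 2 ≤ κ ^ (1 / N) := by
    calc (1 / 2 : ℝ) = (1 / 2 : ℝ) ^ (1 : ℝ) := by rw [Real.rpow_one]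
      _ ≤ (1 / 2 : ℝ) ^ (1 / N) := Real.rpow_le_rpow_of_exponent_ge (by norm_num) (by norm_num)
          (by linarith)
      _ ≤ κ ^ (1 / N) := Real.rpow_le_rpow (by norm_num) hκ (by positivity)
  have hC : 0 ≤ (1 + 1 / η) ^ (N - 1) := by positivity
  have key : ∀ i, 3 / 2 * N * μ i ≤ (1 + η) * D * m ^ (1 / N) * auxTerm d i := by
    intro i
    have ht0 := aux_term_nonneg d hh0 i
    have htP := aux_term_le d hh0 i
    have hDpos : 0 < D := by linarith
    rcases (d.le i).eq_or_lt with heq | hlt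
    · have : μ i = 0 := by simp [hμ, heq]
      rw [this, mul_zero]; positivity
    have hbl : d.b i ≤ l := le_min (aux_b_le d hE i hlt) (d.le_top i)
    set T := (if d.a i ≠ 0 then h (d.a i) else 0) + (if d.b i ≠ l then h (d.b i) else 0) with hT
    have hTt : T ≤ auxTerm d i := by
      rw [hT, auxTerm]
      have hb0 : 0 ≤ h (d.b i) := hh0 _ ⟨(d.nonneg i).trans (d.le i), d.le_top i⟩
      refine add_le_add (by simp [hlt]) ?_
      by_cases hbl' : d.b i = l
      · simp only [hbl', ne_eq, not_true_eq_false, if_false]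
        rw [hbl'] at hb0
        split_ifs <;> simp [hb0]
      · have : d.b i ≠ D' := by
          intro hcon
          exact hbl' (le_antisymm hbl (by rw [hcon]; exact hlD'))
        simp [hlt, hbl', this]
    have hT0 : 0 ≤ T := by
      have ha : 0 ≤ h (d.a i) := hh0 _ ⟨d.nonneg i, (d.le i).trans (d.le_top i)⟩
      have hb : 0 ≤ h (d.b i) := hh0 _ ⟨(d.nonneg i).trans (d.le i), d.le_top i⟩
      rw [hT]
      split_ifs <;> linarith
    have h3 : 3 * (l * T) ≤ D * auxTerm d i := by
      calc 3 * (l * T) = (3 * l) * T := by ring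
        _ ≤ D * auxTerm d i := mul_le_mul (by linarith) hTt hT0 hDpos.le
    have h4 : D * auxTerm d i ≤ D * d.perim := mul_le_mul_of_nonneg_left htP hDpos.le
    have h5 : 0 ≤ l * T := by positivity
    rcases aux_interval hN hη (d.nonneg i) hlt hbl (hc.subset hsub (convex_Icc _ _))
      (fun y hy => hf0 y (hsub hy)) (fun y hy => hf1 y ⟨hy.1, hy.2.trans_le hlD'⟩)
      (fun y hy => hh y (hsub hy)) (hi.mono_set hsub) T hT with h1 | h1 | h1
    · have : (1 + 1 / η) ^ (N - 1) * (l * T) ≤ (1 + 1 / η) ^ (N - 1) * (D * d.perim) :=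
        mul_le_mul_of_nonneg_left (by linarith) hC
      exfalso; linarith
    · have := hμm i
      simp only [hμ] at this
      exfalso; linarith
    · change N * (κ ^ (1 / N) * μ i ^ (1 - 1 / N)) ≤ _ at h1
      have hx0 : 0 ≤ μ i ^ (1 - 1 / N) := Real.rpow_nonneg (hμ0 i) _
      have h6 : 3 / 2 * N * μ i ^ (1 - 1 / N) ≤ (1 + η) * (D * auxTerm d i) := by
        have : N * (1 / 2 * μ i ^ (1 - 1 / N)) ≤ N * (κ ^ (1 / N) * μ i ^ (1 - 1 / N)) := by gcongr
        have h7 : (1 + η) * (3 * (l * T)) ≤ (1 + η) * (D * auxTerm d i) := by gcongr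
        linarith
      have h8 : μ i ≤ μ i ^ (1 - 1 / N) * m ^ (1 / N) := by
        have e : μ i = μ i ^ (1 - 1 / N) * μ i ^ (1 / N) := by
          rw [← Real.rpow_add_of_nonneg (hμ0 i) hα (by positivity)]; simp
        calc μ i = μ i ^ (1 - 1 / N) * μ i ^ (1 / N) := e
          _ ≤ _ := mul_le_mul_of_nonneg_left
              (Real.rpow_le_rpow (hμ0 i) (hμm i) (by positivity)) hx0
      have hm1 : 0 ≤ m ^ (1 / N) := by positivity
      calc 3 / 2 * N * μ i ≤ 3 / 2 * N * (μ i ^ (1 - 1 / N) * m ^ (1 / N)) := by gcongr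
        _ = (3 / 2 * N * μ i ^ (1 - 1 / N)) * m ^ (1 / N) := by ring
        _ ≤ ((1 + η) * (D * auxTerm d i)) * m ^ (1 / N) := by gcongr
        _ = _ := by ring
  have hs2 : HasSum (auxTerm d) d.perim := d.summablePerim.hasSum
  have h9 := hasSum_le key (hsum.mul_left _) (hs2.mul_left _)
  have hm1 : 0 < m ^ (1 / N) := by positivity
  have e : m = m ^ (1 - 1 / N) * m ^ (1 / N) := by
    rw [← Real.rpow_add hm]; simp
  have h10 : (3 / 2 * N * m ^ (1 - 1 / N)) * m ^ (1 / N) ≤ ((1 + η) * (D * d.perim)) * m ^ (1 / N) := by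
    calc _ = 3 / 2 * N * (m ^ (1 - 1 / N) * m ^ (1 / N)) := by ring
      _ = 3 / 2 * N * m := by rw [← e]
      _ ≤ _ := h9
      _ = _ := by ring
  have := le_of_mul_le_mul_right h10 hm1
  linarith

theorem aux_exists_max {N L D' : ℝ} {f h : ℝ → ℝ} {E : Set ℝ} (hN : 1 < N)
    (hLD : L < D') (hE : E ⊆ Set.Icc 0 L) (d : IntervalDecomp D' h E)
    (hc : ConcaveOn ℝ (Set.Icc 0 D') f)
    (hf0 : ∀ y ∈ Set.Icc 0 D', 0 ≤ f y) (hf1 : ∀ y ∈ Set.Ioo 0 D', 0 < f y)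
    (hh : ∀ y ∈ Set.Icc 0 D', h y = f y ^ (N - 1))
    (hi : IntegrableOn h (Set.Icc 0 D'))
    (hm : 0 < ∫ x in E, h x) :
    ∃ i, d.a i < d.b i ∧ ∀ j, d.a j < d.b j → d.b j ≤ d.b i := by
  have hh0 : ∀ y ∈ Set.Icc 0 D', 0 ≤ h y := fun y hy => by
    rw [hh y hy]; exact Real.rpow_nonneg (hf0 y hy) _
  obtain ⟨i1, hi1⟩ : ∃ i, d.a i < d.b i := by
    by_contra hcon
    push Not at hcon
    have hsum := aux_hasSum d hi
    have : (fun i => ∫ x in Set.Ioo (d.a i) (d.b i), h x) = fun _ => 0 := by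
      funext i
      simp [Set.Ioo_eq_empty (not_lt.2 (hcon i))]
    rw [this] at hsum
    have := hsum.unique hasSum_zero
    linarith
  have hb1 : 0 < d.b i1 := (d.nonneg i1).trans_lt hi1
  have hb1L : d.b i1 ≤ L := aux_b_le d hE i1 hi1
  have hL : 0 < L := hb1.trans_le hb1L
  set c := (min (f (d.b i1)) (f L)) ^ (N - 1) with hcdef
  have hmin : 0 < min (f (d.b i1)) (f L) := lt_min (hf1 _ ⟨hb1, by linarith⟩) (hf1 _ ⟨hL, hLD⟩)
  have hc0 : 0 < c := Real.rpow_pos_of_pos hmin _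
  set S := {i | d.a i < d.b i ∧ d.b i1 ≤ d.b i} with hS
  have hfin : S.Finite := by
    have hsm : Summable (auxTerm d) := d.summablePerim
    have h1 := hsm.tendsto_cofinite_zero.eventually_lt_const hc0
    rw [Filter.eventually_cofinite] at h1
    refine h1.subset ?_
    rintro i ⟨hi2, hi3⟩
    simp only [Set.mem_ofPred_eq, not_lt]
    have hbL : d.b i ≤ L := aux_b_le d hE i hi2
    have hmem : d.b i ∈ Set.Icc 0 D' := ⟨by linarith, by linarith⟩
    have h2 : c ≤ h (d.b i) := by
      rw [hh _ hmem, hcdef]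
      refine Real.rpow_le_rpow hmin.le ?_ (by linarith)
      exact hc.min_le_of_mem_Icc ⟨hb1.le, by linarith⟩ ⟨hL.le, hLD.le⟩ ⟨hi3, hbL⟩
    have h3 : d.b i ≠ D' := by intro hcon; linarith
    have ha : 0 ≤ h (d.a i) := hh0 _ ⟨d.nonneg i, (d.le i).trans (d.le_top i)⟩
    rw [auxTerm, if_pos (⟨hi2, h3⟩ : d.a i < d.b i ∧ d.b i ≠ D')]
    split_ifs <;> linarith
  obtain ⟨i0, hi0, hmax⟩ := Set.exists_max_image S d.b hfin ⟨i1, hi1, le_rfl⟩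
  refine ⟨i0, hi0.1, fun j hj => ?_⟩
  rcases le_total (d.b i1) (d.b j) with h1 | h1
  · exact hmax j ⟨hj, h1⟩
  · exact h1.trans hi0.2

theorem aux_essSup {D' : ℝ} {h : ℝ → ℝ} {E : Set ℝ} (d : IntervalDecomp D' h E) (i : ℕ)
    (hi : d.a i < d.b i) (hmax : ∀ j, d.a j < d.b j → d.b j ≤ d.b i) :
    essSupSet E = d.b i := by
  have : {t : ℝ | volume (E ∩ Set.Ioi t) = 0} = Set.Ici (d.b i) := by
    ext t
    have e : volume (E ∩ Set.Ioi t) = volume ((⋃ i, Set.Ioo (d.a i) (d.b i)) ∩ Set.Ioi t) :=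
      measure_congr (d.aeEq.inter (ae_eq_refl _))
    simp only [Set.mem_ofPred_eq, Set.mem_Ici, e]
    constructor
    · intro h0
      by_contra hcon
      push Not at hcon
      have h1 : Set.Ioo (max (d.a i) t) (d.b i) ⊆ (⋃ i, Set.Ioo (d.a i) (d.b i)) ∩ Set.Ioi t :=
        fun y hy => ⟨Set.mem_iUnion.2 ⟨i, (le_max_left _ _).trans_lt hy.1, hy.2⟩,
          (le_max_right _ _).trans_lt hy.1⟩
      have h2 := measure_mono_null h1 h0
      rw [Real.volume_Ioo, ENNReal.ofReal_eq_zero] at h2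
      have : max (d.a i) t < d.b i := max_lt hi hcon
      linarith
    · intro ht
      have : (⋃ i, Set.Ioo (d.a i) (d.b i)) ∩ Set.Ioi t = ∅ := by
        rw [Set.eq_empty_iff_forall_notMem]
        rintro y ⟨hy, hyt⟩
        obtain ⟨j, hj⟩ := Set.mem_iUnion.1 hy
        have h1 := hmax j (hj.1.trans hj.2)
        have h2 : t < y := hyt
        linarith [hj.2]
      rw [this, measure_empty]
  rw [essSupSet, this, csInf_Ici]

/-- Choice of parameters. -/
theorem aux_params {N ε : ℝ} (hN : 1 < N) (hε : 0 < ε) :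
    ∃ r δ w : ℝ, 0 < r ∧ r < 1 ∧ 0 < δ ∧ 0 < w ∧ N * r ≤ ε ∧
      (∀ x ∈ Set.Icc (0:ℝ) 1, ∀ y ∈ Set.Icc (0:ℝ) 1, |x - y| ≤ r →
        N * |x ^ (N - 1) - y ^ (N - 1)| ≤ ε / 2) ∧
      (1 + δ) * (1 + δ) * (1 - r ^ N) ^ (1 - 1 / N) < 1 ∧
      N * (((1 + δ) * (1 + δ)) ^ (1 / (1 - 1 / N)) - 1) ≤ ε / 2 ∧
      N * ((1 + δ) * (1 + δ) - 1) ≤ ε ∧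
      (1 + δ) * (1 + δ) < 3 / 2 ∧
      (1 + 1 / δ) ^ (N - 1) * ((1 + δ) * (N * w ^ (1 - 1 / N))) < 1 / 2 ∧
      w + (1 + δ) * (N * w ^ (1 - 1 / N)) < 1 / 2 := by
  have hN0 : 0 < N := by linarith
  have hα : 0 < 1 - 1 / N := by
    have : 1 / N < 1 := by rw [div_lt_one hN0]; exact hN
    linarith
  have hp : 0 < N - 1 := by linarith
  -- uniform continuity
  have huc : UniformContinuousOn (fun x : ℝ => x ^ (N - 1)) (Set.Icc 0 1) :=
    isCompact_Icc.uniformContinuousOn_of_continuous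
      (Real.continuous_rpow_const hp.le).continuousOn
  rw [Metric.uniformContinuousOn_iff] at huc
  obtain ⟨r0, hr0, huc⟩ := huc (ε / (2 * N)) (by positivity)
  set r := min (r0 / 2) (min (1 / 2) (ε / N)) with hr
  have hrpos : 0 < r := lt_min (by linarith) (lt_min (by norm_num) (by positivity))
  have hr1 : r ≤ 1 / 2 := (min_le_right _ _).trans (min_le_left _ _)
  have hr2 : r ≤ ε / N := (min_le_right _ _).trans (min_le_right _ _)
  have hr3 : r ≤ r0 / 2 := min_le_left _ _
  have hA : (1 - r ^ N) ^ (1 - 1 / N) < 1 := by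
    have h1 : 0 < r ^ N := Real.rpow_pos_of_pos hrpos _
    have h2 : r ^ N ≤ 1 := Real.rpow_le_one hrpos.le (by linarith) hN0.le
    exact Real.rpow_lt_one (by linarith) (by linarith) hα
  -- choice of delta
  have hcΛ : Filter.Tendsto (fun δ : ℝ => (1 + δ) * (1 + δ)) (nhdsWithin 0 (Set.Ioi 0)) (nhds 1) := by
    have : Continuous (fun δ : ℝ => (1 + δ) * (1 + δ)) := by fun_prop
    have := this.tendsto 0
    simp only [add_zero, mul_one] at this
    exact this.mono_left nhdsWithin_le_nhds
  have e1 := (hcΛ.mul_const ((1 - r ^ N) ^ (1 - 1 / N))).eventually_lt_const (by simpa using hA)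
  have e2 := (((hcΛ.rpow_const (p := 1 / (1 - 1 / N)) (Or.inl one_ne_zero)).sub_const 1).const_mul N).eventually_lt_const
    (show N * ((1:ℝ) ^ (1 / (1 - 1 / N)) - 1) < ε / 2 by simp; exact hε)
  have e3 := ((hcΛ.sub_const 1).const_mul N).eventually_lt_const
    (show N * ((1:ℝ) - 1) < ε by simpa using hε)
  have e4 := hcΛ.eventually_lt_const (show (1:ℝ) < 3 / 2 by norm_num)
  obtain ⟨δ, ⟨⟨⟨h1, h2⟩, h3⟩, h4⟩, hδ⟩ :=
    (((e1.and e2).and e3).and e4 |>.and self_mem_nhdsWithin).exists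
  have hδ0 : 0 < δ := hδ
  -- choice of w
  have hw : Filter.Tendsto (fun w : ℝ => (1 + δ) * (N * w ^ (1 - 1 / N))) (nhdsWithin 0 (Set.Ioi 0))
      (nhds 0) := by
    have : Continuous (fun w : ℝ => (1 + δ) * (N * w ^ (1 - 1 / N))) :=
      continuous_const.mul (continuous_const.mul (Real.continuous_rpow_const hα.le))
    have := this.tendsto 0
    simp only [Real.zero_rpow hα.ne', mul_zero] at this
    exact this.mono_left nhdsWithin_le_nhds
  have hw0 : Filter.Tendsto (fun w : ℝ => w) (nhdsWithin 0 (Set.Ioi 0)) (nhds 0) :=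
    nhdsWithin_le_nhds
  have g1 := (hw.const_mul ((1 + 1 / δ) ^ (N - 1))).eventually_lt_const
    (show (1 + 1 / δ) ^ (N - 1) * 0 < (1:ℝ) / 2 by norm_num)
  have g2 := (hw0.add hw).eventually_lt_const (show (0:ℝ) + 0 < 1 / 2 by norm_num)
  obtain ⟨w, ⟨k1, k2⟩, hwpos⟩ := ((g1.and g2).and self_mem_nhdsWithin).exists
  refine ⟨r, δ, w, hrpos, by linarith, hδ0, hwpos, ?_, ?_, h1, h2.le, h3.le, h4, k1, k2⟩
  · rw [le_div_iff₀ hN0] at hr2; linarith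
  · intro x hx y hy hxy
    have := huc x hx y hy (by rw [Real.dist_eq]; linarith)
    rw [Real.dist_eq, lt_div_iff₀ (by positivity)] at this
    linarith

/-- Consequences of near-equality. -/
theorem aux_conseq {N δ ρ r m M D hb ta : ℝ} (hN : 1 < N) (hδ : 0 < δ) (hρ0 : 0 ≤ ρ) (hρ1 : ρ < 1)
    (hr0 : 0 < r) (hr1 : r < 1)
    (hm : 0 < m) (hmM : m ≤ M) (hD : 0 < D) (hhb : 0 < hb) (hta : 0 ≤ ta)
    (h1 : N * M ^ (1 - 1 / N) ≤ (1 + δ) * (D * hb) * (1 - ρ ^ N) ^ (1 - 1 / N))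
    (h2 : D * (ta + hb) ≤ (1 + δ) * (N * m ^ (1 - 1 / N)))
    (hr : (1 + δ) * (1 + δ) * (1 - r ^ N) ^ (1 - 1 / N) < 1) :
    ρ ≤ r ∧ M ≤ ((1 + δ) * (1 + δ)) ^ (1 / (1 - 1 / N)) * m ∧
      ta ≤ ((1 + δ) * (1 + δ) - 1) * hb := by
  have hN0 : 0 < N := by linarith
  have hα : 0 < 1 - 1 / N := by
    have : 1 / N < 1 := by rw [div_lt_one hN0]; exact hN
    linarith
  have hρN : 0 ≤ ρ ^ N := Real.rpow_nonneg hρ0 _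
  have hρN1 : ρ ^ N ≤ 1 := Real.rpow_le_one hρ0 hρ1.le hN0.le
  set q := (1 - ρ ^ N) ^ (1 - 1 / N) with hq
  have hq0 : 0 ≤ q := Real.rpow_nonneg (by linarith) _
  have hq1 : q ≤ 1 := Real.rpow_le_one (by linarith) (by linarith) hα.le
  have hM0 : 0 < M := by linarith
  have hma : 0 < m ^ (1 - 1 / N) := by positivity
  have hmMa : m ^ (1 - 1 / N) ≤ M ^ (1 - 1 / N) := Real.rpow_le_rpow hm.le hmM hα.le
  have h3 : D * hb ≤ (1 + δ) * (N * m ^ (1 - 1 / N)) := by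
    have : 0 ≤ D * ta := by positivity
    linarith
  have h4 : M ^ (1 - 1 / N) ≤ (1 + δ) * (1 + δ) * q * m ^ (1 - 1 / N) := by
    have : N * M ^ (1 - 1 / N) ≤ N * ((1 + δ) * (1 + δ) * q * m ^ (1 - 1 / N)) := by
      calc _ ≤ (1 + δ) * (D * hb) * q := h1
        _ ≤ (1 + δ) * ((1 + δ) * (N * m ^ (1 - 1 / N))) * q := by gcongr
        _ = _ := by ring
    exact le_of_mul_le_mul_left this hN0
  refine ⟨?_, ?_, ?_⟩
  · by_contra hcon
    push Not at hcon
    have h5 : r ^ N ≤ ρ ^ N := Real.rpow_le_rpow hr0.le hcon.le hN0.le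
    have h6 : q ≤ (1 - r ^ N) ^ (1 - 1 / N) := Real.rpow_le_rpow (by linarith) (by linarith) hα.le
    have h7 : (1 + δ) * (1 + δ) * q < 1 :=
      lt_of_le_of_lt (mul_le_mul_of_nonneg_left h6 (by positivity)) hr
    nlinarith
  · have h5 : M ^ (1 - 1 / N) ≤ (1 + δ) * (1 + δ) * m ^ (1 - 1 / N) := by
      refine h4.trans (mul_le_mul_of_nonneg_right ?_ hma.le)
      exact mul_le_of_le_one_right (by positivity) hq1
    have h6 := Real.rpow_le_rpow (by positivity) h5 (by positivity : 0 ≤ 1 / (1 - 1 / N))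
    rw [Real.mul_rpow (by positivity) hma.le, ← Real.rpow_mul hM0.le, ← Real.rpow_mul hm.le,
      mul_one_div_cancel hα.ne', Real.rpow_one, Real.rpow_one] at h6
    exact h6
  · have h5 : N * m ^ (1 - 1 / N) ≤ (1 + δ) * (D * hb) := by
      calc N * m ^ (1 - 1 / N) ≤ N * M ^ (1 - 1 / N) := by gcongr
        _ ≤ _ := h1
        _ ≤ _ := mul_le_of_le_one_right (by positivity) hq1
    have h6 : D * (ta + hb) ≤ D * ((1 + δ) * (1 + δ) * hb) := by
      calc _ ≤ (1 + δ) * (N * m ^ (1 - 1 / N)) := h2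
        _ ≤ (1 + δ) * ((1 + δ) * (D * hb)) := by gcongr
        _ = _ := by ring
    have := le_of_mul_le_mul_left h6 hD
    linarith

set_option maxHeartbeats 2000000 in
theorem aux_main {N L D D' ε r δ w : ℝ} {h : ℝ → ℝ} {E : Set ℝ} (hN : 1 < N) (hL : 0 < L)
    (hε : 0 < ε) (hr0 : 0 < r) (hr1 : r < 1) (hδ : 0 < δ)
    (q1 : N * r ≤ ε)
    (q2 : ∀ x ∈ Set.Icc (0:ℝ) 1, ∀ y ∈ Set.Icc (0:ℝ) 1, |x - y| ≤ r →
        N * |x ^ (N - 1) - y ^ (N - 1)| ≤ ε / 2)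
    (q3 : (1 + δ) * (1 + δ) * (1 - r ^ N) ^ (1 - 1 / N) < 1)
    (q4 : N * (((1 + δ) * (1 + δ)) ^ (1 / (1 - 1 / N)) - 1) ≤ ε / 2)
    (q5 : N * ((1 + δ) * (1 + δ) - 1) ≤ ε)
    (q6 : (1 + δ) * (1 + δ) < 3 / 2)
    (q7 : (1 + 1 / δ) ^ (N - 1) * ((1 + δ) * (N * w ^ (1 - 1 / N))) < 1 / 2)
    (q8 : w + (1 + δ) * (N * w ^ (1 - 1 / N)) < 1 / 2)
    (hD : 3 * L ≤ D) (hD' : D' ∈ Set.Ioc (0:ℝ) D) (hP : IsProbCDDensity N D' h)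
    (hE : E ⊆ Set.Icc 0 L) (d : IntervalDecomp D' h E)
    (hm : 0 < ∫ x in E, h x) (hmw : (∫ x in E, h x) ≤ w)
    (hres : D * d.perim / (N * (∫ x in E, h x) ^ (1 - 1 / N)) - 1 ≤ δ) :
    ∀ᵐ t ∂(volume.restrict (Set.Ioo (0:ℝ) 1)),
          |tildeDensity h E t - N * t ^ (N - 1)| ≤ ε := by
  obtain ⟨⟨hh0, hhpos, hc⟩, hone⟩ := hP
  have hN0 : 0 < N := by linarith
  have hp : 0 < N - 1 := by linarith
  have hα : 0 < 1 - 1 / N := by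
    have : 1 / N < 1 := by rw [div_lt_one hN0]; exact hN
    linarith
  have hDpos : 0 < D := by linarith
  set f : ℝ → ℝ := fun x => h x ^ (1 / (N - 1)) with hfdef
  have hf0 : ∀ y ∈ Set.Icc 0 D', 0 ≤ f y := fun y hy => Real.rpow_nonneg (hh0 y hy) _
  have hf1 : ∀ y ∈ Set.Ioo 0 D', 0 < f y := fun y hy => Real.rpow_pos_of_pos (hhpos y hy) _
  have hh : ∀ y ∈ Set.Icc 0 D', h y = f y ^ (N - 1) := fun y hy => by
    rw [hfdef]
    simp only
    rw [← Real.rpow_mul (hh0 y hy), one_div_mul_cancel hp.ne', Real.rpow_one]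
  have hi : IntegrableOn h (Set.Icc 0 D') := by
    by_contra hcon
    rw [integral_undef hcon] at hone
    norm_num at hone
  set m := ∫ x in E, h x with hmdef
  have hma : 0 < m ^ (1 - 1 / N) := by positivity
  have hQ : D * d.perim ≤ (1 + δ) * (N * m ^ (1 - 1 / N)) := by
    have : D * d.perim / (N * m ^ (1 - 1 / N)) ≤ 1 + δ := by linarith
    rwa [div_le_iff₀ (by positivity)] at this
  have hmwa : m ^ (1 - 1 / N) ≤ w ^ (1 - 1 / N) := Real.rpow_le_rpow hm.le hmw hα.le
  have hQw : D * d.perim ≤ (1 + δ) * (N * w ^ (1 - 1 / N)) := hQ.trans (by gcongr)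
  have hC : 0 ≤ (1 + 1 / δ) ^ (N - 1) := by positivity
  have hCQ : (1 + 1 / δ) ^ (N - 1) * (D * d.perim) < 1 / 2 :=
    lt_of_le_of_lt (mul_le_mul_of_nonneg_left hQw hC) q7
  have hmQ : m + D * d.perim < 1 / 2 := by linarith
  have hQ2 : (1 + δ) * (D * d.perim) < 3 / 2 * N * m ^ (1 - 1 / N) := by
    calc (1 + δ) * (D * d.perim) ≤ (1 + δ) * ((1 + δ) * (N * m ^ (1 - 1 / N))) := by gcongr
      _ = ((1 + δ) * (1 + δ)) * (N * m ^ (1 - 1 / N)) := by ring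
      _ < (3 / 2) * (N * m ^ (1 - 1 / N)) := by gcongr
      _ = _ := by ring
  -- we are in case B
  have hκ : ∫ x in Set.Icc 0 (min L D'), h x < 1 / 2 := by
    by_contra hcon
    push Not at hcon
    exact aux_caseA hN hL hδ hD hD' hE d hc hf0 hf1 hh hi hm hCQ hmQ hQ2 hcon
  have hLD : L < D' := by
    by_contra hcon
    push Not at hcon
    rw [min_eq_right hcon, hone] at hκ
    norm_num at hκ
  rw [min_eq_left hLD.le] at hκ
  obtain ⟨i, hab, hmax⟩ := aux_exists_max hN hLD hE d hc hf0 hf1 hh hi hm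
  have hess := aux_essSup d i hab hmax
  have hterm := aux_term_le d hh0 i
  set b := d.b i with hbdef
  set a := d.a i with hadef
  have ha0 : 0 ≤ a := d.nonneg i
  have hb0 : 0 < b := ha0.trans_lt hab
  have hbL : b ≤ L := aux_b_le d hE i hab
  have hbD : b < D' := by linarith
  have hbm : b ∈ Set.Ioo 0 D' := ⟨hb0, hbD⟩
  have hbm' : b ∈ Set.Icc 0 D' := ⟨hb0.le, hbD.le⟩
  have ham : a ∈ Set.Icc 0 D' := ⟨ha0, by linarith⟩
  have hhb : 0 < h b := hhpos b hbm
  have hfb : 0 < f b := hf1 b hbm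
  set ta := if a ≠ 0 then h a else 0 with hta
  have hta0 : 0 ≤ ta := by
    rw [hta]; split_ifs
    · exact hh0 a ham
    · exact le_rfl
  have hteq : auxTerm d i = ta + h b := by
    have hab' : d.a i < d.b i := hab
    have hbD2 : d.b i ≠ D' := hbD.ne
    simp only [auxTerm, hab', true_and, hbD2, ne_eq, not_false_eq_true, if_true, hta]
    rfl
  have hDt : D * (ta + h b) ≤ D * d.perim := by
    rw [← hteq]; exact mul_le_mul_of_nonneg_left hterm hDpos.le
  have hDhb : D' * h b ≤ D * d.perim := by
    have h1 : D' * h b ≤ D * h b := mul_le_mul_of_nonneg_right hD'.2 hhb.le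
    have h2 : D * h b ≤ D * (ta + h b) := mul_le_mul_of_nonneg_left (by linarith) hDpos.le
    linarith
  have nn : ∀ S : Set ℝ, MeasurableSet S → S ⊆ Set.Icc 0 D' → 0 ≤ᵐ[volume.restrict S] h :=
    fun S hS h2 => (ae_restrict_iff' hS).2 (Filter.Eventually.of_forall fun y hy => hh0 y (h2 hy))
  have hbsub : Set.Icc 0 b ⊆ Set.Icc 0 D' := Set.Icc_subset_Icc_right hbD.le
  set M := ∫ x in Set.Icc 0 b, h x with hM
  have hMhalf : M < 1 / 2 := by
    refine lt_of_le_of_lt ?_ hκ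
    exact setIntegral_mono_set (hi.mono_set (Set.Icc_subset_Icc_right hLD.le))
      (nn _ measurableSet_Icc (Set.Icc_subset_Icc_right hLD.le))
      (Filter.Eventually.of_forall (Set.Icc_subset_Icc_right hbL))
  have hmM : m ≤ M := by
    rw [hmdef, setIntegral_congr_set d.aeEq]
    refine setIntegral_mono_set (hi.mono_set hbsub) (nn _ measurableSet_Icc hbsub)
      (Filter.Eventually.of_forall (Set.iUnion_subset fun j y hy => ?_))
    exact ⟨(d.nonneg j).trans hy.1.le, hy.2.le.trans (hmax j (hy.1.trans hy.2))⟩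
  obtain ⟨s, hs⟩ := aux_supergrad hc hbm
  have hs0 : 0 ≤ s := by
    by_contra hcon
    push Not at hcon
    have h1 := aux_int_le hbD.le (hi.mono_set (Set.Icc_subset_Icc_left hb0.le))
        (g := fun _ => h b) continuous_const (fun y hy => by
          have hy' : y ∈ Set.Icc 0 D' := ⟨by linarith [hy.1], hy.2⟩
          rw [hh y hy', hh b hbm']
          refine Real.rpow_le_rpow (hf0 y hy') ?_ hp.le
          nlinarith [hs y hy', hy.1])
    rw [intervalIntegral.integral_const, smul_eq_mul, aux_Icc hbD.le] at h1
    have i1 : IntervalIntegrable h volume 0 b :=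
      (intervalIntegrable_iff_integrableOn_Icc_of_le hb0.le).2 (hi.mono_set hbsub)
    have i3 : IntervalIntegrable h volume b D' :=
      (intervalIntegrable_iff_integrableOn_Icc_of_le hbD.le).2
        (hi.mono_set (Set.Icc_subset_Icc_left hb0.le))
    have e1 := intervalIntegral.integral_add_adjacent_intervals i1 i3
    rw [aux_Icc hD'.1.le] at hone
    rw [aux_Icc hb0.le] at hM
    have e2 : (D' - b) * h b ≤ D' * h b := mul_le_mul_of_nonneg_right (by linarith) hhb.le
    linarith
  rcases aux_core hN hδ hbm hf0 hfb hh hi hs0 hs with h1 | ⟨ρ, hρ0, hρ1, h1, h2, h3⟩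
  · rw [hone] at h1
    have := mul_le_mul_of_nonneg_left hDhb hC
    exfalso; linarith
  rw [hone, Real.one_rpow, one_mul, ← hM] at h1
  rw [← hM] at h3
  have hρN1 : ρ ^ N ≤ 1 := Real.rpow_le_one hρ0 hρ1.le hN0.le
  have h1' : N * M ^ (1 - 1 / N) ≤ (1 + δ) * (D * h b) * (1 - ρ ^ N) ^ (1 - 1 / N) := by
    refine h1.trans ?_
    have : 0 ≤ (1 - ρ ^ N) ^ (1 - 1 / N) := Real.rpow_nonneg (by linarith) _
    gcongr
    exact hD'.2
  obtain ⟨c1, c2, c3⟩ := aux_conseq hN hδ hρ0 hρ1 hr0 hr1 hm hmM hDpos hhb hta0 h1'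
    (hDt.trans hQ) q3
  -- chord bound
  have chord : ∀ y ∈ Set.Icc 0 b, h b * (y / b) ^ (N - 1) ≤ h y := by
    intro y hy
    have hy' := hbsub hy
    have ht0 : 0 ≤ y / b := div_nonneg hy.1 hb0.le
    have ht1 : y / b ≤ 1 := by rw [div_le_one hb0]; exact hy.2
    have := hc.2 (⟨le_rfl, hD'.1.le⟩ : (0:ℝ) ∈ Set.Icc 0 D') hbm'
      (by linarith : 0 ≤ 1 - y / b) ht0 (by ring)
    simp only [smul_eq_mul, mul_zero, zero_add] at this
    rw [div_mul_cancel₀ _ hb0.ne'] at this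
    have h00 := hf0 0 ⟨le_rfl, hD'.1.le⟩
    have h4 : f b * (y / b) ≤ f y := by
      have : (1 - y / b) * f 0 + (y / b) * f b ≤ f y := this
      nlinarith
    rw [hh y hy', hh b hbm', ← Real.mul_rpow hfb.le ht0]
    exact Real.rpow_le_rpow (by positivity) h4 hp.le
  have hbhb : b * h b ≤ N * M := by
    have h4 := aux_le_int hb0.le (hi.mono_set hbsub) (g := fun y => h b * (y / b + 0) ^ (N - 1))
      (continuous_const.mul (aux_cont hN)) (fun y hy => by simpa using chord y hy)
    rw [intervalIntegral.integral_const_mul, aux_int hN hb0, ← hM] at h4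
    rw [zero_div, add_zero, add_zero, div_self hb0.ne', Real.one_rpow,
      Real.zero_rpow hN0.ne', sub_zero, mul_one] at h4
    calc b * h b = N * (h b * (b / N)) := by field_simp
      _ ≤ _ := by gcongr
  -- almost everywhere statement
  have hnull : volume {y : ℝ | ¬ (y ∈ E ↔ y ∈ ⋃ i, Set.Ioo (d.a i) (d.b i))} = 0 := by
    have := d.aeEq
    have h5 : ∀ᵐ y : ℝ, (y ∈ E ↔ y ∈ ⋃ i, Set.Ioo (d.a i) (d.b i)) := by
      filter_upwards [this] with y hy
      exact iff_of_eq hy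
    exact h5
  have hae : ∀ᵐ t : ℝ, (b * t ∈ E ↔ b * t ∈ ⋃ i, Set.Ioo (d.a i) (d.b i)) := by
    have h5 := Real.volume_preimage_mul_left hb0.ne'
      {y : ℝ | ¬ (y ∈ E ↔ y ∈ ⋃ i, Set.Ioo (d.a i) (d.b i))}
    rw [hnull, mul_zero] at h5
    exact h5
  rw [ae_restrict_iff' measurableSet_Ioo]
  filter_upwards [hae] with t ht htm
  obtain ⟨ht0, ht1⟩ := htm
  have htp0 : 0 ≤ t ^ (N - 1) := Real.rpow_nonneg ht0.le _
  have htp1 : t ^ (N - 1) ≤ 1 := Real.rpow_le_one ht0.le ht1.le hp.le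
  have hdiv : b * t / b = t := by field_simp
  have hym : b * t ∈ Set.Icc 0 b := ⟨mul_nonneg hb0.le ht0.le, mul_le_of_le_one_right hb0.le ht1.le⟩
  rw [tildeDensity, hess, ← hmdef]
  by_cases hyE : b * t ∈ E
  · rw [Set.indicator_of_mem hyE]
    have l1 := chord _ hym
    have u1 := h2 _ hym
    rw [hdiv] at l1 u1
    set z := t + ρ * (1 - t) with hz
    have h1t : 0 ≤ 1 - t := by linarith only [ht1]
    have hρt0 : 0 ≤ ρ * (1 - t) := mul_nonneg hρ0 h1t
    have hρt1 : ρ * (1 - t) ≤ 1 - t := mul_le_of_le_one_left h1t hρ1.le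
    have hρt2 : ρ * (1 - t) ≤ ρ := mul_le_of_le_one_right hρ0 (by linarith only [ht0])
    have hz0 : 0 ≤ z := add_nonneg ht0.le hρt0
    have hz1 : z ≤ 1 := by linarith only [hz, hρt1]
    have hzp0 : 0 ≤ z ^ (N - 1) := Real.rpow_nonneg hz0 _
    have hzp1 : z ^ (N - 1) ≤ 1 := Real.rpow_le_one hz0 hz1 hp.le
    have hclose := q2 z ⟨hz0, hz1⟩ t ⟨ht0.le, ht1.le⟩ (by
      rw [abs_le]; constructor <;> linarith only [hz, hρt0, hρt2, c1, hr0])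
    have hclose' : N * (z ^ (N - 1) - t ^ (N - 1)) ≤ ε / 2 :=
      (mul_le_mul_of_nonneg_left (le_abs_self _) hN0.le).trans hclose
    set Λ := ((1 + δ) * (1 + δ)) ^ (1 / (1 - 1 / N)) with hΛ
    -- upper
    have up : b / m * h (b * t) ≤ N * Λ * z ^ (N - 1) := by
      rw [div_mul_eq_mul_div, div_le_iff₀ hm]
      calc b * h (b * t) ≤ b * (h b * z ^ (N - 1)) := mul_le_mul_of_nonneg_left u1 hb0.le
        _ = (b * h b) * z ^ (N - 1) := by ring
        _ ≤ (N * (Λ * m)) * z ^ (N - 1) := by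
            refine mul_le_mul_of_nonneg_right ?_ hzp0
            exact hbhb.trans (mul_le_mul_of_nonneg_left c2 hN0.le)
        _ = _ := by ring
    have lo : N * (1 - ρ) * t ^ (N - 1) ≤ b / m * h (b * t) := by
      rw [div_mul_eq_mul_div, le_div_iff₀ hm]
      have h1ρ : 0 ≤ 1 - ρ := by linarith
      calc N * (1 - ρ) * t ^ (N - 1) * m = (N * m * (1 - ρ)) * t ^ (N - 1) := by ring
        _ ≤ (N * M * (1 - ρ)) * t ^ (N - 1) :=
            mul_le_mul_of_nonneg_right (mul_le_mul_of_nonneg_right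
              (mul_le_mul_of_nonneg_left hmM hN0.le) h1ρ) htp0
        _ ≤ (b * h b) * t ^ (N - 1) := mul_le_mul_of_nonneg_right h3 htp0
        _ = b * (h b * t ^ (N - 1)) := by ring
        _ ≤ _ := mul_le_mul_of_nonneg_left l1 hb0.le
    have hα' : 0 < 1 - 1 / N := by
      have : 1 / N < 1 := (div_lt_one hN0).2 hN
      linarith only [this]
    have hδδ : 1 ≤ (1 + δ) * (1 + δ) :=
      one_le_mul_of_one_le_of_one_le (by linarith only [hδ]) (by linarith only [hδ])
    have hΛ1 : 1 ≤ Λ := Real.one_le_rpow hδδ (one_div_pos.2 hα').le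
    rw [abs_le]
    constructor
    · have h6 : N * ρ * t ^ (N - 1) ≤ N * r * 1 :=
        mul_le_mul (mul_le_mul_of_nonneg_left c1 hN0.le) htp1 htp0 (by positivity)
      have h7 : N * (1 - ρ) * t ^ (N - 1) = N * t ^ (N - 1) - N * ρ * t ^ (N - 1) := by ring
      linarith
    · have h6 : N * (Λ - 1) * z ^ (N - 1) ≤ N * (Λ - 1) :=
        mul_le_of_le_one_right (mul_nonneg hN0.le (by linarith)) hzp1
      have h7 : N * Λ * z ^ (N - 1) = N * (Λ - 1) * z ^ (N - 1) +
          N * (z ^ (N - 1) - t ^ (N - 1)) + N * t ^ (N - 1) := by ring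
      linarith
  · rw [Set.indicator_of_notMem hyE, zero_sub, abs_neg, abs_of_nonneg (by positivity)]
    have hyU : b * t ∉ ⋃ i, Set.Ioo (d.a i) (d.b i) := fun hcon => hyE (ht.2 hcon)
    have hyb : b * t < b := mul_lt_of_lt_one_right hb0 ht1
    have hya : b * t ≤ a := by
      by_contra hcon
      push Not at hcon
      exact hyU (Set.mem_iUnion.2 ⟨i, hcon, hyb⟩)
    have hapos : 0 < a := lt_of_lt_of_le (by positivity) hya
    have htaeq : ta = h a := by rw [hta, if_pos hapos.ne']
    have h5 := chord a ⟨ha0, hab.le⟩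
    have h6 : t ^ (N - 1) ≤ (a / b) ^ (N - 1) :=
      Real.rpow_le_rpow ht0.le (by rw [le_div_iff₀ hb0]; linarith) hp.le
    have h7 : h b * t ^ (N - 1) ≤ h b * ((1 + δ) * (1 + δ) - 1) := by
      calc _ ≤ h b * (a / b) ^ (N - 1) := mul_le_mul_of_nonneg_left h6 hhb.le
        _ ≤ h a := h5
        _ ≤ _ := by rw [← htaeq]; linarith
    have h8 := le_of_mul_le_mul_left h7 hhb
    calc N * t ^ (N - 1) ≤ N * ((1 + δ) * (1 + δ) - 1) := mul_le_mul_of_nonneg_left h8 hN0.le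
      _ ≤ ε := q5

/-- Proposition 5.10: for small `m_h(E)` and small residual, the normalized rescaled density
`h̃_E` is uniformly (a.e. on `(0,1)`) `ε`-close to the model density `N t^{N-1}`. -/
theorem tilde_density_close_to_model (N L : ℝ) (hN : 1 < N) (hL : 0 < L) :
    ∀ ε : ℝ, 0 < ε → ∃ wbar : ℝ, 0 < wbar ∧ ∃ δbar : ℝ, 0 < δbar ∧
      ∀ D D' : ℝ, 3 * L ≤ D → D' ∈ Set.Ioc (0:ℝ) D →
      ∀ h : ℝ → ℝ, IsProbCDDensity N D' h →
      ∀ E : Set ℝ, E ⊆ Set.Icc 0 L →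
      ∀ d : IntervalDecomp D' h E,
        0 < (∫ x in E, h x) → (∫ x in E, h x) ≤ wbar →
        D * d.perim / (N * (∫ x in E, h x) ^ (1 - 1 / N)) - 1 ≤ δbar →
        ∀ᵐ t ∂(volume.restrict (Set.Ioo (0:ℝ) 1)),
          |tildeDensity h E t - N * t ^ (N - 1)| ≤ ε := by
  intro ε hε
  obtain ⟨r, δ, w, hr0, hr1, hδ, hw, q1, q2, q3, q4, q5, q6, q7, q8⟩ := aux_params hN hε
  refine ⟨w, hw, δ, hδ, ?_⟩
  intro D D' hD hD' h hP E hE d hm hmw hres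
  exact aux_main hN hL hε hr0 hr1 hδ q1 q2 q3 q4 q5 q6 q7 q8 hD hD' hP hE d hm hmw hres
end
end
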